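/- Let k be a power of 3 and M = m^{k/3} for an integer m with |m| ≥ 2. If Φ_k(m) = Y^q for integers Y ≥ 1, q ≥ 2, then setting X = 2M + 1 one has X² + 3 = 4Y^q; by the theorem of Luca–Tengely–Togbé, the only solutions of X² + 3 = 4Y^q with X, Y, q ≥ 1, q ≥ 2 are (X,Y) = (1,1) and (X,Y,q) = (37,7,3); hence M ∈ {-19, -1, 0, 18}. -/

import Mathlib

namespace P3
open QuadraticAlgebra

/-- Eisenstein integers. -/
abbrev EI := QuadraticAlgebra ℤ (-1) (-1)

lemma nrm (z : EI) : norm z = z.re ^ 2 - z.re * z.im + z.im ^ 2 := by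
  rw [norm_def]; ring

lemma nrm_nonneg (z : EI) : 0 ≤ norm z := by
  rw [nrm]; nlinarith [sq_nonneg (z.re - z.im), sq_nonneg z.re, sq_nonneg z.im]

lemma nrm_eq_zero {z : EI} (h : norm z = 0) : z = 0 := by
  rw [nrm] at h
  have h1 : z.re = 0 := by
    have : 3 * z.re ^ 2 ≤ 0 := by nlinarith [sq_nonneg (z.re - 2 * z.im)]
    exact pow_eq_zero_iff (two_ne_zero) |>.1 (le_antisymm (by linarith) (sq_nonneg _))
  have h2 : z.im = 0 := by
    rw [h1] at h
    exact pow_eq_zero_iff (two_ne_zero) |>.1 (by linarith)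
  ext <;> simp [h1, h2]

instance : NoZeroDivisors EI where
  eq_zero_or_eq_zero_of_mul_eq_zero {a b} h := by
    have : norm a * norm b = 0 := by rw [← map_mul, h, QuadraticAlgebra.norm_zero]
    rcases mul_eq_zero.1 this with h | h
    · exact Or.inl (nrm_eq_zero h)
    · exact Or.inr (nrm_eq_zero h)

instance : IsDomain EI := NoZeroDivisors.to_isDomain _

lemma int_round (u N : ℤ) (hN : 0 < N) : ∃ p : ℤ, |2 * (u - N * p)| ≤ N := by
  refine ⟨(2 * u + N) / (2 * N), ?_⟩
  have h1 := Int.mul_ediv_add_emod (2 * u + N) (2 * N)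
  have h2 := Int.emod_nonneg (2 * u + N) (b := 2 * N) (by lia)
  have h3 := Int.emod_lt_of_pos (2 * u + N) (b := 2 * N) (by lia)
  rw [abs_le]
  constructor <;> nlinarith

lemma exists_quot (x y : EI) (hy : y ≠ 0) : ∃ q : EI, norm (x - y * q) < norm y := by
  have hN : 0 < norm y := lt_of_le_of_ne (nrm_nonneg y) (fun h => hy (nrm_eq_zero h.symm))
  obtain ⟨p1, h1⟩ := int_round (x * star y).re (norm y) hN
  obtain ⟨p2, h2⟩ := int_round (x * star y).im (norm y) hN
  refine ⟨⟨p1, p2⟩, ?_⟩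
  have e : norm (x - y * ⟨p1, p2⟩) * norm y =
      norm (⟨(x * star y).re - norm y * p1, (x * star y).im - norm y * p2⟩ : EI) := by
    have : norm (x - y * ⟨p1, p2⟩) * norm y = norm ((x - y * ⟨p1, p2⟩) * star y) := by
      rw [map_mul, QuadraticAlgebra.norm_star]
    rw [this]; congr 1
    ext
    · simp [norm_def]; ring
    · simp [norm_def]; ring
  have e2 : norm (x - y * ⟨p1, p2⟩) * norm y < norm y * norm y := by
    rw [e, nrm]
    simp only
    generalize (x * star y).re - norm y * p1 = r1 at *
    generalize (x * star y).im - norm y * p2 = r2 at *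
    generalize norm y = N at *
    rw [abs_le] at h1 h2
    have a1 : 4 * r1 ^ 2 ≤ N ^ 2 := by nlinarith
    have a2 : 4 * r2 ^ 2 ≤ N ^ 2 := by nlinarith
    nlinarith [sq_nonneg (r1 + r2)]
  exact lt_of_mul_lt_mul_right e2 hN.le

open Classical in
noncomputable instance : EuclideanDomain EI :=
  { (inferInstance : CommRing EI), (inferInstance : Nontrivial EI) with
    quotient := fun x y => if h : y = 0 then 0 else (exists_quot x y h).choose
    quotient_zero := fun x => by simp
    remainder := fun x y => x - y * (if h : y = 0 then 0 else (exists_quot x y h).choose)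
    quotient_mul_add_remainder_eq := fun x y => by ring
    r := fun x y => (norm x).natAbs < (norm y).natAbs
    r_wellFounded := (measure fun x : EI => (norm x).natAbs).wf
    remainder_lt := fun x y hy => by
      have := (exists_quot x y hy).choose_spec
      simp only [hy, dite_false]
      have h0 := nrm_nonneg (x - y * (exists_quot x y hy).choose)
      lia
    mul_left_not_lt := fun x y hy => by
      rw [map_mul, Int.natAbs_mul, not_lt]
      have : norm y ≠ 0 := fun h => hy (nrm_eq_zero h)
      exact Nat.le_mul_of_pos_right _ (Int.natAbs_pos.2 this) }

lemma unit_cases (u : EIˣ) : (u : EI) = ⟨1,0⟩ ∨ (u : EI) = ⟨-1,0⟩ ∨ (u : EI) = ⟨0,1⟩ ∨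
    (u : EI) = ⟨0,-1⟩ ∨ (u : EI) = ⟨1,1⟩ ∨ (u : EI) = ⟨-1,-1⟩ := by
  have h : IsUnit (norm (u : EI)) := isUnit_iff_norm_isUnit.1 u.isUnit
  have h1 : norm (u : EI) = 1 := by
    rcases Int.isUnit_iff.1 h with h | h
    · exact h
    · have := nrm_nonneg (u : EI); lia
  rw [nrm] at h1
  obtain ⟨⟨a, b⟩, hu⟩ : ∃ z : EI, z = u := ⟨u, rfl⟩
  rw [← hu] at h1 ⊢
  simp only at h1
  have ha : a ^ 2 ≤ 1 := by nlinarith [sq_nonneg (a - 2 * b)]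
  have hb : b ^ 2 ≤ 1 := by nlinarith [sq_nonneg (b - 2 * a)]
  have ha1 : -1 ≤ a ∧ a ≤ 1 := by constructor <;> nlinarith
  have hb1 : -1 ≤ b ∧ b ≤ 1 := by constructor <;> nlinarith
  obtain ⟨a1, a2⟩ := ha1
  obtain ⟨b1, b2⟩ := hb1
  interval_cases a <;> interval_cases b <;> simp_all

lemma unit_pow_six (u : EIˣ) : (u : EI) ^ 6 = 1 := by
  rcases unit_cases u with h | h | h | h | h | h <;> rw [h] <;> rfl

/-- coprimality of `s - Dω` with its conjugate -/
lemma coprime_conj (s D A : ℤ) (q : ℕ) (hq : 2 ≤ q) (hc : IsCoprime s D)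
    (h : s ^ 2 + s * D + D ^ 2 = A ^ q) :
    IsCoprime (⟨s, -D⟩ : EI) (star ⟨s, -D⟩) := by
  have h3 : ¬ (3 : ℤ) ∣ A := by
    intro h3
    have h9 : (9 : ℤ) ∣ s ^ 2 + s * D + D ^ 2 := by
      rw [h]
      exact (by norm_num : (9 : ℤ) = 3 ^ 2) ▸ (pow_dvd_pow_of_dvd h3 2).trans (pow_dvd_pow A hq)
    obtain ⟨k, hk⟩ := h9
    have : (3 : ℤ) ∣ s - D := by
      have : (3 : ℤ) ∣ (s - D) ^ 2 := ⟨3 * k - s * D, by linarith⟩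
      exact Int.prime_three.dvd_of_dvd_pow this
    obtain ⟨j, hj⟩ := this
    have hs : s = D + 3 * j := by linarith
    have : (3 : ℤ) ∣ D ^ 2 := ⟨k * 1 - D * j - j ^ 2, by subst hs; linarith⟩
    have hD := Int.prime_three.dvd_of_dvd_pow this
    have hs' : (3 : ℤ) ∣ s := by rw [hs]; exact dvd_add hD (Dvd.intro j rfl)
    have := hc.isUnit_of_dvd' hs' hD
    rw [Int.isUnit_iff] at this
    lia
  have hc3 : IsCoprime (3 : ℤ) (s ^ 2 + s * D + D ^ 2) := by
    rw [h]
    exact ((Int.prime_three.coprime_iff_not_dvd).2 h3).pow_right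
  have hcD : IsCoprime D (s ^ 2 + s * D + D ^ 2) := by
    have : s ^ 2 + s * D + D ^ 2 = s ^ 2 + D * (s + D) := by ring
    rw [this]
    exact (hc.symm.pow_right (n := 2)).add_mul_left_right _
  have hcD2 : IsCoprime (3 * D ^ 2) (s ^ 2 + s * D + D ^ 2) :=
    hc3.mul_left hcD.pow_left
  obtain ⟨u, v, huv⟩ := hcD2
  -- 3 D^2 = (z - conj)·stuff
  refine ⟨(u : EI) * (⟨1,2⟩ * (⟨D, 0⟩)) + v * star ⟨s, -D⟩, (u : EI) * (-⟨1,2⟩ * (⟨D, 0⟩)), ?_⟩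
  ext
  · simp
    linear_combination huv
  · simp
    ring

lemma eisen_pow (s D A : ℤ) (q : ℕ) (hq : 2 ≤ q) (hc : IsCoprime s D)
    (h : s ^ 2 + s * D + D ^ 2 = A ^ q) :
    ∃ (u : EIˣ) (α : EI), (⟨s, -D⟩ : EI) = u * α ^ q := by
  have hco := coprime_conj s D A q hq hc h
  have hm : (⟨s, -D⟩ : EI) * star ⟨s, -D⟩ = (A : EI) ^ q := by
    have : (A : EI) ^ q = ((A ^ q : ℤ) : EI) := by push_cast; rfl
    rw [this, ← h]
    ext
    · rw [re_intCast]; simp; ring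
    · rw [im_intCast]; simp; ring
  obtain ⟨d, u, hu⟩ := exists_associated_pow_of_mul_eq_pow' hco hm
  exact ⟨u, d, by rw [← hu]; ring⟩

lemma eisen_cube (s D A : ℤ) (hc : IsCoprime s D)
    (h : s ^ 2 + s * D + D ^ 2 = A ^ 3) :
    ∃ (α : EI), (⟨s, -D⟩ : EI) = α ^ 3 ∨ (⟨s, -D⟩ : EI) = ⟨0,1⟩ * α ^ 3 ∨
      (⟨s, -D⟩ : EI) = ⟨-1,-1⟩ * α ^ 3 := by
  obtain ⟨u, α, hu⟩ := eisen_pow s D A 3 (by norm_num) hc h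
  have hn : ∀ a b : ℤ, (⟨-a,-b⟩ : EI) * α ^ 3 = ⟨a,b⟩ * (-α) ^ 3 := by
    intro a b
    have : (⟨-a,-b⟩ : EI) = -⟨a,b⟩ := rfl
    rw [this]; ring
  have h1 : (⟨1,0⟩ : EI) = 1 := rfl
  rcases unit_cases u with h | h | h | h | h | h <;> rw [h] at hu
  · exact ⟨α, Or.inl (by rw [hu, h1, one_mul])⟩
  · have := hn 1 0
    rw [neg_zero] at this
    exact ⟨-α, Or.inl (by rw [hu, this, h1, one_mul])⟩
  · exact ⟨α, Or.inr (Or.inl hu)⟩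
  · have := hn 0 1
    rw [neg_zero] at this
    exact ⟨-α, Or.inr (Or.inl (by rw [hu, this]))⟩
  · have := hn (-1) (-1)
    rw [neg_neg] at this
    exact ⟨-α, Or.inr (Or.inr (by rw [hu, this]))⟩
  · exact ⟨α, Or.inr (Or.inr hu)⟩

lemma eisen_pow6 (s D A : ℤ) (q : ℕ) (hq : 2 ≤ q) (hq6 : q % 6 = 1 ∨ q % 6 = 5)
    (hc : IsCoprime s D)
    (h : s ^ 2 + s * D + D ^ 2 = A ^ q) :
    ∃ (α : EI), (⟨s, -D⟩ : EI) = α ^ q := by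
  obtain ⟨u, α, hu⟩ := eisen_pow s D A q hq hc h
  refine ⟨(u : EI) ^ q * α, ?_⟩
  rw [hu, mul_pow, ← pow_mul]
  congr 1
  have : ∃ k, q * q = 6 * k + 1 := by
    have h6 : q * q % 6 = 1 := by
      rcases hq6 with h | h <;> simp [Nat.mul_mod, h]
    exact ⟨q * q / 6, by omega⟩
  obtain ⟨k, hk⟩ := this
  rw [hk, pow_succ, pow_mul, unit_pow_six, one_pow, one_mul]

end P3

namespace P3
open QuadraticAlgebra

lemma two_pow_aux (q L r : ℕ) (hr : 3 ≤ r) (hq : 2 ^ L ∣ q - 1) (hq2 : 2 ≤ q) :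
    2 ^ L ∣ q.choose r * 2 ^ (r - 2) := by
  obtain ⟨s, rfl⟩ : ∃ s, r = s + 2 := ⟨r - 2, by omega⟩
  obtain ⟨p, rfl⟩ : ∃ p, q = p + 2 := ⟨q - 2, by omega⟩
  have e1 := Nat.add_one_mul_choose_eq (p + 1) (s + 1)
  have e2 := Nat.add_one_mul_choose_eq p s
  have e : (p + 2).choose (s + 2) * ((s + 2) * (s + 1)) = (p + 2) * ((p + 1) * p.choose s) := by
    rw [e2]
    have : (p + 1 + 1) * (p + 1).choose (s + 1) = (p + 2).choose (s + 2) * (s + 2) := e1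
    linear_combination (s + 1) * this.symm
  obtain ⟨a, o, ho, hao⟩ := Nat.exists_eq_two_pow_mul_odd (n := (s + 2) * (s + 1)) (by positivity)
  have ha : 2 ^ a ≤ s + 2 := by
    have hd : 2 ^ a ∣ (s + 2) * (s + 1) := ⟨o, hao⟩
    rcases Nat.even_or_odd s with h | h
    · have hc : Nat.Coprime (2 ^ a) (s + 1) :=
        Nat.Coprime.pow_left _ ((Nat.coprime_two_left).2 h.add_one)
      exact Nat.le_of_dvd (by omega) (hc.dvd_of_dvd_mul_right hd)
    · have hc : Nat.Coprime (2 ^ a) (s + 2) :=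
        Nat.Coprime.pow_left _ ((Nat.coprime_two_left).2 (by rw [Nat.odd_add]; simp [h]))
      exact (Nat.le_of_dvd (by omega) (hc.dvd_of_dvd_mul_left hd)).trans (by omega)
  have has : a ≤ s := by
    by_contra hlt
    have h1 : 2 ^ (s + 1) ≤ 2 ^ a := Nat.pow_le_pow_right (by norm_num) (by omega)
    have h2 : ∀ s : ℕ, 1 ≤ s → s + 2 < 2 ^ (s + 1) := by
      intro s hs
      induction s, hs using Nat.le_induction with
      | base => norm_num
      | succ n hn ih => rw [pow_succ]; omega
    have := h2 s (by omega)
    omega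
  have hd : 2 ^ L ∣ ((p + 2).choose (s + 2) * 2 ^ a) * o := by
    rw [mul_assoc, ← hao, e]
    have : 2 ^ L ∣ p + 1 := hq
    exact Dvd.dvd.mul_left (this.mul_right _) _
  have hco : Nat.Coprime (2 ^ L) o := Nat.Coprime.pow_left _ ((Nat.coprime_two_left).2 ho)
  have := hco.dvd_of_dvd_mul_right hd
  refine this.trans ?_
  exact Nat.mul_dvd_mul_left _ (pow_dvd_pow 2 (by simpa using has))

lemma omega_pow_mod (n : ℕ) : (⟨0, 1⟩ : EI) ^ n = ⟨0, 1⟩ ^ (n % 3) := by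
  conv_lhs => rw [← Nat.div_add_mod n 3, pow_add, pow_mul]
  have : (⟨0, 1⟩ : EI) ^ 3 = 1 := rfl
  rw [this, one_pow, one_mul]

lemma pow_six_mod (z : EI) (hz : z ^ 6 = 1) (n : ℕ) : z ^ n = z ^ (n % 6) := by
  conv_lhs => rw [← Nat.div_add_mod n 6, pow_add, pow_mul]
  rw [hz, one_pow, one_mul]

lemma im_mod3 (t : ℤ) (ht : t % 3 ≠ 2) (q : ℕ) :
    (q % 6 = 1 → ((⟨t, 1⟩ : EI) ^ q).im % 3 = 1) ∧ (q % 6 = 5 → ((⟨t, 1⟩ : EI) ^ q).im % 3 = 2) := by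
  have key : ∀ c : ℤ, (3 : ℤ) ∣ t - c → ∃ w : EI, (⟨t, 1⟩ : EI) ^ q = ⟨c, 1⟩ ^ q + 3 * w := by
    rintro c ⟨j, hj⟩
    have h1 := sub_dvd_pow_sub_pow (⟨t, 1⟩ : EI) ⟨c, 1⟩ q
    have h2 : (⟨t, 1⟩ : EI) - ⟨c, 1⟩ = 3 * ⟨j, 0⟩ := by
      ext
      · simp [hj]
      · simp
    rw [h2] at h1
    obtain ⟨w, hw⟩ := h1
    exact ⟨⟨j, 0⟩ * w, by rw [← mul_assoc, ← hw]; ring⟩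
  have h6 : ∀ c : ℤ, (c = 0 ∨ c = 1) → (⟨c, 1⟩ : EI) ^ 6 = 1 := by
    rintro c (rfl | rfl) <;> rfl
  have hex : ∃ c : ℤ, (c = 0 ∨ c = 1) ∧ (3 : ℤ) ∣ t - c := by
    have : t % 3 = 0 ∨ t % 3 = 1 := by lia
    rcases this with h | h
    · exact ⟨0, Or.inl rfl, by lia⟩
    · exact ⟨1, Or.inr rfl, by lia⟩
  obtain ⟨c, hc, hd⟩ := hex
  obtain ⟨w, hw⟩ := key c hd
  rw [pow_six_mod _ (h6 c hc)] at hw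
  constructor
  · intro hq
    rw [hq] at hw
    rw [hw]
    simp
  · intro hq
    rw [hq] at hw
    rw [hw]
    have : ((⟨c, 1⟩ : EI) ^ 5).im = -1 := by
      rcases hc with rfl | rfl <;> rfl
    simp [this]

lemma exp3 (t : ℤ) (q L : ℕ) (hq : 3 ≤ q) (hL : 2 ^ L ∣ q - 1) (ht : Even t) :
    ∃ W : EI, (⟨t, 1⟩ : EI) ^ q = ⟨0, 1⟩ ^ q + q * t * ⟨0, 1⟩ ^ (q - 1) +
      (q.choose 2 : EI) * t ^ 2 * ⟨0, 1⟩ ^ (q - 2) + t ^ 2 * 2 ^ L * W := by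
  obtain ⟨τ, hτ⟩ := ht
  have h0 : (⟨t, 1⟩ : EI) = (t : EI) + ⟨0, 1⟩ := by ext <;> simp
  rw [h0, add_pow]
  obtain ⟨p, rfl⟩ : ∃ p, q = p + 2 := ⟨q - 2, by omega⟩
  rw [show p + 2 + 1 = 3 + p by ring, Finset.sum_range_add]
  have hdiv : ∀ i ∈ Finset.range p, (t : EI) ^ 2 * 2 ^ L ∣
      (t : EI) ^ (3 + i) * ⟨0, 1⟩ ^ (p + 2 - (3 + i)) * ((p + 2).choose (3 + i) : EI) := by
    intro i _
    obtain ⟨c, hc⟩ := two_pow_aux (p + 2) L (3 + i) (by omega) hL (by omega)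
    have hc' : ((p + 2).choose (3 + i) : EI) * 2 ^ (i + 1) = 2 ^ L * c := by
      have : 3 + i - 2 = i + 1 := by omega
      rw [this] at hc
      exact_mod_cast hc
    have ht2 : (t : EI) = 2 * (τ : EI) := by rw [hτ]; push_cast; ring
    refine ⟨(τ : EI) ^ (i + 1) * c * ⟨0, 1⟩ ^ (p + 2 - (3 + i)), ?_⟩
    have : (t : EI) ^ (3 + i) = t ^ 2 * (2 ^ (i + 1) * (τ : EI) ^ (i + 1)) := by
      rw [← mul_pow, ← ht2]; ring
    rw [this]
    linear_combination (t : EI) ^ 2 * (τ : EI) ^ (i + 1) * ⟨0, 1⟩ ^ (p + 2 - (3 + i)) * hc'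
  obtain ⟨W, hW⟩ := Finset.dvd_sum hdiv
  refine ⟨W, ?_⟩
  rw [hW]
  simp only [Finset.sum_range_succ, Finset.sum_range_zero]
  simp
  ring

lemma im_main (t : ℤ) (q : ℕ) (hq5 : 5 ≤ q) (hq6 : q % 6 = 1 ∨ q % 6 = 5) (hte : Even t)
    (ht3 : t % 3 ≠ 2) (h : ((⟨t, 1⟩ : EI) ^ q).im = 1 ∨ ((⟨t, 1⟩ : EI) ^ q).im = -1) : t = 0 := by
  by_contra ht0
  obtain ⟨hm1, hm5⟩ := im_mod3 t ht3 q
  rcases hq6 with h6 | h6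
  · have him : ((⟨t, 1⟩ : EI) ^ q).im = 1 := by
      have := hm1 h6
      rcases h with h | h
      · exact h
      · rw [h] at this; norm_num at this
    obtain ⟨L, m, hm, hLm⟩ := Nat.exists_eq_two_pow_mul_odd (n := q - 1) (by omega)
    obtain ⟨W, hW⟩ := exp3 t q L (by omega) ⟨m, hLm⟩ hte
    rw [omega_pow_mod q, omega_pow_mod (q - 1), omega_pow_mod (q - 2), show q % 3 = 1 by omega,
      show (q - 1) % 3 = 0 by omega, show (q - 2) % 3 = 2 by omega] at hW
    have e2 : (⟨0, 1⟩ : EI) ^ 2 = ⟨-1, -1⟩ := rfl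
    have e3 : (t : EI) ^ 2 * 2 ^ L * W = ((t ^ 2 * 2 ^ L : ℤ) : EI) * W := by push_cast; ring
    have e4 : (q.choose 2 : EI) * t ^ 2 * (⟨0, 1⟩ : EI) ^ 2 =
        ((q.choose 2 * t ^ 2 : ℤ) : EI) * ⟨-1, -1⟩ := by rw [e2]; push_cast; ring
    have e5 : (q : EI) * t * ⟨0, 1⟩ ^ 0 = ((q * t : ℤ) : EI) := by push_cast; ring
    rw [e3, e4, e5] at hW
    have := congrArg QuadraticAlgebra.im hW
    rw [him] at this
    simp only [im_add, im_mul, re_intCast, im_intCast, pow_one] at this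
    have e6 : t ^ 2 * ((q.choose 2 : ℤ) - 2 ^ L * W.im) = 0 := by
      simp only [Int.cast_id] at this
      linear_combination this
    have e7 : (q.choose 2 : ℤ) = 2 ^ L * W.im := by
      rcases mul_eq_zero.1 e6 with h | h
      · exact absurd (pow_eq_zero_iff two_ne_zero |>.1 h) ht0
      · linarith
    have e8 : q.choose 2 * 2 = q * (q - 1) := by
      have := Nat.add_one_mul_choose_eq (q - 1) 1
      rw [Nat.sub_add_cancel (by omega)] at this
      rw [Nat.choose_one_right] at this
      exact this.symm
    rw [hLm] at e8
    have e9 : (q.choose 2 : ℤ) * 2 = q * (2 ^ L * m) := by exact_mod_cast e8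
    have e10 : 2 * W.im = q * m := by
      have h2 : (2 : ℤ) ^ L ≠ 0 := by positivity
      apply mul_left_cancel₀ h2
      linear_combination e9 - 2 * e7
    have hqo : Odd q := by rw [Nat.odd_iff]; omega
    have : Odd ((q : ℤ) * m) := by exact_mod_cast hqo.mul hm
    rw [← e10] at this
    exact (Int.not_odd_iff_even.2 (even_two_mul _)) this
  · have him : ((⟨t, 1⟩ : EI) ^ q).im = -1 := by
      have := hm5 h6
      rcases h with h | h
      · rw [h] at this; norm_num at this
      · exact h
    obtain ⟨W, hW⟩ := Polynomial.powAddExpansion (⟨0, 1⟩ : EI) (t : EI) q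
    have h0 : (⟨t, 1⟩ : EI) = ⟨0, 1⟩ + (t : EI) := by ext <;> simp
    rw [← h0, omega_pow_mod q, omega_pow_mod (q - 1), show q % 3 = 2 by omega,
      show (q - 1) % 3 = 1 by omega] at hW
    have e2 : (⟨0, 1⟩ : EI) ^ 2 = ⟨-1, -1⟩ := rfl
    have e3 : W * (t : EI) ^ 2 = W * ((t ^ 2 : ℤ) : EI) := by push_cast; ring
    have e5 : (q : EI) * ⟨0, 1⟩ ^ 1 * t = ((q * t : ℤ) : EI) * ⟨0, 1⟩ := by push_cast; ring
    rw [e2, e3, e5] at hW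
    have := congrArg QuadraticAlgebra.im hW
    rw [him] at this
    simp only [im_add, im_mul, re_intCast, im_intCast, Int.cast_id] at this
    have e6 : t * (q + t * W.im) = 0 := by linear_combination -this
    have e7 : (q : ℤ) = - (t * W.im) := by
      rcases mul_eq_zero.1 e6 with h | h
      · exact absurd h ht0
      · linarith
    have hqo : Odd (q : ℤ) := by exact_mod_cast (show Odd q by rw [Nat.odd_iff]; omega)
    rw [e7] at hqo
    exact (Int.not_odd_iff_even.2 ((hte.mul_right _).neg)) hqo

lemma dvd_im_pow (a b : ℤ) (n : ℕ) : b ∣ ((⟨a, b⟩ : EI) ^ n).im := by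
  induction n with
  | zero => simp
  | succ n ih =>
    rw [pow_succ]
    simp only [im_mul]
    obtain ⟨c, hc⟩ := ih
    rw [hc]
    exact ⟨((⟨a, b⟩ : EI) ^ n).re + c * a - b * c, by ring⟩

theorem case6 (x Y : ℤ) (q : ℕ) (hY : 1 ≤ Y) (hq5 : 5 ≤ q) (hq6 : q % 6 = 1 ∨ q % 6 = 5)
    (h : x ^ 2 + x + 1 = Y ^ q) : Y = 1 := by
  obtain ⟨α, hα⟩ := eisen_pow6 x 1 Y q (by omega) hq6 isCoprime_one_right (by linarith)
  obtain ⟨a, b⟩ := α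
  have hqo : Odd q := by rw [Nat.odd_iff]; omega
  have hb : b ∣ 1 := by
    have := dvd_im_pow a b q
    rw [← hα] at this
    simpa using this
  have hN : norm (⟨a, b⟩ : EI) = Y := by
    have h1 : norm (⟨x, -1⟩ : EI) = norm (⟨a, b⟩ : EI) ^ q := by rw [hα, map_pow]
    rw [nrm] at h1
    simp only at h1
    have h2 : norm (⟨a, b⟩ : EI) ^ q = Y ^ q := by rw [← h1, ← h]; ring
    exact hqo.strictMono_pow.injective h2
  have hex : ∃ t : ℤ, t ^ 2 - t + 1 = Y ∧
      (((⟨t, 1⟩ : EI) ^ q).im = 1 ∨ ((⟨t, 1⟩ : EI) ^ q).im = -1) := by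
    rcases Int.isUnit_iff.1 (isUnit_of_dvd_one hb) with rfl | rfl
    · refine ⟨a, ?_, Or.inr ?_⟩
      · rw [← hN, nrm]; ring
      · rw [← hα]
    · refine ⟨-a, ?_, Or.inl ?_⟩
      · rw [← hN, nrm]; ring
      · have : (⟨-a, 1⟩ : EI) = -⟨a, -1⟩ := rfl
        rw [this, hqo.neg_pow, ← hα]
        rfl
  obtain ⟨t, htY, ht⟩ := hex
  have ht3 : t % 3 ≠ 2 := by
    intro ht3
    have h3 : (3 : ℤ) ∣ Y := by
      rw [← htY]
      obtain ⟨j, hj⟩ : ∃ j, t = 3 * j + 2 := ⟨t / 3, by lia⟩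
      exact ⟨3 * j ^ 2 + 3 * j + 1, by rw [hj]; ring⟩
    have h9 : (9 : ℤ) ∣ x ^ 2 + x + 1 := by
      rw [h]
      exact (by norm_num : (9 : ℤ) = 3 ^ 2) ▸ (pow_dvd_pow_of_dvd h3 2).trans
        (pow_dvd_pow Y (by omega))
    have : ∀ y : ZMod 9, y ^ 2 + y + 1 ≠ 0 := by decide
    apply this x
    have := (ZMod.intCast_zmod_eq_zero_iff_dvd (x ^ 2 + x + 1) 9).2 h9
    push_cast at this
    exact this
  rcases Int.even_or_odd t with hte | hto
  · rw [← htY, im_main t q hq5 hq6 hte ht3 ht]; norm_num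
  · have hs : (⟨1 - t, 1⟩ : EI) = - star ⟨t, 1⟩ := by
      ext
      · simp; ring
      · simp
    have hs' : ((⟨1 - t, 1⟩ : EI) ^ q).im = ((⟨t, 1⟩ : EI) ^ q).im := by
      rw [hs, hqo.neg_pow, ← star_pow, im_neg, im_star, neg_neg]
    have hte : Even (1 - t) := by
      rcases hto with ⟨j, rfl⟩; exact ⟨-j, by ring⟩
    have := im_main (1 - t) q hq5 hq6 hte (by lia) (by rw [hs']; exact ht)
    rw [← htY, show t = 1 by lia]; norm_num

end P3

namespace P3

/-- the elliptic divisibility sequence attached to `(1,0)` on `y²+y=x³-1` -/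
def W (n : ℕ) : ℤ := normEDS 1 (-6) (-37) (n : ℤ)

lemma W0 : W 0 = 0 := by simp [W]
lemma W1 : W 1 = 1 := by simp [W]
lemma W2 : W 2 = 1 := by
  have := normEDS_two (1 : ℤ) (-6) (-37)
  exact_mod_cast this
lemma W3 : W 3 = -6 := by
  have := normEDS_three (1 : ℤ) (-6) (-37)
  exact_mod_cast this
lemma W4 : W 4 = -37 := by
  have := normEDS_four (1 : ℤ) (-6) (-37)
  rw [mul_one] at this
  exact_mod_cast this

lemma W_odd (m : ℕ) : W (2 * (m + 2) + 1) =
    W (m + 4) * W (m + 2) ^ 3 - W (m + 1) * W (m + 3) ^ 3 := by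
  have := normEDS_odd (1 : ℤ) (-6) (-37) (m + 2)
  simp only [W]
  push_cast
  rw [this, show (m : ℤ) + 2 - 1 = m + 1 by ring, show (m : ℤ) + 2 + 2 = m + 4 by ring,
    show (m : ℤ) + 2 + 1 = m + 3 by ring]

lemma W_even (m : ℕ) : W (2 * (m + 3)) =
    W (m + 3) * (W (m + 2) ^ 2 * W (m + 5) - W (m + 1) * W (m + 4) ^ 2) := by
  have := normEDS_even (1 : ℤ) (-6) (-37) (m + 3)
  rw [mul_one] at this
  simp only [W]
  push_cast
  rw [this, show (m : ℤ) + 3 - 1 = m + 2 by ring, show (m : ℤ) + 3 - 2 = m + 1 by ring,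
    show (m : ℤ) + 3 + 2 = m + 5 by ring, show (m : ℤ) + 3 + 1 = m + 4 by ring]
  ring

/-- residues modulo 16 -/
def tab (n : ℕ) : ZMod 16 :=
  [0,1,1,10,11,3,4,5,13,14,7,7,8,9,9,2,3,11,12,13,5,6,15,15].getD n 0

lemma W_mod16 (n : ℕ) : ((W n : ℤ) : ZMod 16) = tab (n % 24) := by
  induction n using normEDSRec with
  | zero => rw [W0]; decide
  | one => rw [W1]; decide
  | two => rw [W2]; decide
  | three => rw [W3]; decide
  | four => rw [W4]; decide
  | even m h1 h2 h3 h4 h5 =>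
    rw [W_even]
    push_cast
    rw [h1, h2, h3, h4, h5]
    have key : ∀ r < 24, tab ((r + 3) % 24) * (tab ((r + 2) % 24) ^ 2 * tab ((r + 5) % 24) -
      tab ((r + 1) % 24) * tab ((r + 4) % 24) ^ 2) = tab ((2 * (r + 3)) % 24) := by decide
    have := key (m % 24) (Nat.mod_lt _ (by norm_num))
    simpa [Nat.add_mod, Nat.mul_mod] using this
  | odd m h1 h2 h3 h4 =>
    rw [W_odd]
    push_cast
    rw [h1, h2, h3, h4]
    have key : ∀ r < 24, tab ((r + 4) % 24) * tab ((r + 2) % 24) ^ 3 -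
      tab ((r + 1) % 24) * tab ((r + 3) % 24) ^ 3 = tab ((2 * (r + 2) + 1) % 24) := by decide
    have := key (m % 24) (Nat.mod_lt _ (by norm_num))
    simpa [Nat.add_mod, Nat.mul_mod] using this

/-- residues modulo 3 -/
def tab3 (n : ℕ) : ZMod 3 := [0,1,1,0,2,2].getD n 0

lemma W_mod3 (n : ℕ) : ((W n : ℤ) : ZMod 3) = tab3 (n % 6) := by
  induction n using normEDSRec with
  | zero => rw [W0]; decide
  | one => rw [W1]; decide
  | two => rw [W2]; decide
  | three => rw [W3]; decide
  | four => rw [W4]; decide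
  | even m h1 h2 h3 h4 h5 =>
    rw [W_even]
    push_cast
    rw [h1, h2, h3, h4, h5]
    have key : ∀ r < 6, tab3 ((r + 3) % 6) * (tab3 ((r + 2) % 6) ^ 2 * tab3 ((r + 5) % 6) -
      tab3 ((r + 1) % 6) * tab3 ((r + 4) % 6) ^ 2) = tab3 ((2 * (r + 3)) % 6) := by decide
    have := key (m % 6) (Nat.mod_lt _ (by norm_num))
    simpa [Nat.add_mod, Nat.mul_mod] using this
  | odd m h1 h2 h3 h4 =>
    rw [W_odd]
    push_cast
    rw [h1, h2, h3, h4]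
    have key : ∀ r < 6, tab3 ((r + 4) % 6) * tab3 ((r + 2) % 6) ^ 3 -
      tab3 ((r + 1) % 6) * tab3 ((r + 3) % 6) ^ 3 = tab3 ((2 * (r + 2) + 1) % 6) := by decide
    have := key (m % 6) (Nat.mod_lt _ (by norm_num))
    simpa [Nat.add_mod, Nat.mul_mod] using this

lemma W_mod3_ne (n : ℕ) : ¬ ((3 : ℤ) ∣ W n ∧ (3 : ℤ) ∣ W (n + 1)) := by
  rintro ⟨h1, h2⟩
  have a1 := (ZMod.intCast_zmod_eq_zero_iff_dvd (W n) 3).2 h1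
  have a2 := (ZMod.intCast_zmod_eq_zero_iff_dvd (W (n + 1)) 3).2 h2
  rw [W_mod3] at a1 a2
  have key : ∀ r < 6, ¬ (tab3 r = 0 ∧ tab3 ((r + 1) % 6) = 0) := by decide
  apply key (n % 6) (Nat.mod_lt _ (by norm_num))
  exact ⟨a1, by simpa [Nat.add_mod] using a2⟩

lemma W_even_iff (n : ℕ) : Even (W n) ↔ 3 ∣ n := by
  have h : Even (W n) ↔ 8 * ((W n : ℤ) : ZMod 16) = 0 := by
    have : 8 * ((W n : ℤ) : ZMod 16) = ((8 * W n : ℤ) : ZMod 16) := by push_cast; rfl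
    rw [this, ZMod.intCast_zmod_eq_zero_iff_dvd, Int.even_iff]
    push_cast
    omega
  rw [h, W_mod16]
  have key : ∀ r < 24, (8 * tab r = 0 ↔ r % 3 = 0) := by decide
  rw [key _ (Nat.mod_lt _ (by norm_num))]
  omega

lemma W_mod2_ne (n : ℕ) : ¬ ((2 : ℤ) ∣ W n ∧ (2 : ℤ) ∣ W (n + 1)) := by
  rintro ⟨h1, h2⟩
  have a1 := (W_even_iff n).1 (even_iff_two_dvd.2 h1)
  have a2 := (W_even_iff (n + 1)).1 (even_iff_two_dvd.2 h2)
  omega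

lemma W_emod16 (n r : ℕ) (v : ℤ) (hn : n % 24 = r) (hr : tab r = (v : ZMod 16)) :
    ∃ z, W n = v + 16 * z := by
  have := W_mod16 n
  rw [hn, hr, ZMod.intCast_eq_intCast_iff_dvd_sub] at this
  obtain ⟨z, hz⟩ := this
  exact ⟨-z, by push_cast at hz; linarith⟩

/-- the 2-adic claim -/
lemma claimA (e : ℕ) (j : ℕ) (hj : Odd j) :
    ∃ a b c d : ℤ, W (3 * 2 ^ (e + 1) * j) = 2 * 2 ^ (e + 1) * a ∧
      W (3 * 2 ^ (e + 1) * j + 1) = 1 + 2 * 2 ^ (e + 1) + 4 * 2 ^ (e + 1) * b ∧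
      W (3 * 2 ^ (e + 1) * j - 1) = - (1 + 2 * 2 ^ (e + 1) + 4 * 2 ^ (e + 1) * c) ∧
      W (3 * 2 ^ (e + 1) * j + 1) * W (3 * 2 ^ (e + 1) * j - 1) = -1 + 8 * 2 ^ (e + 1) * d := by
  induction e with
  | zero =>
    simp only [zero_add, pow_one]
    obtain ⟨i, rfl⟩ := hj
    have : 3 * 2 * (2 * i + 1) % 24 = 6 ∨ 3 * 2 * (2 * i + 1) % 24 = 18 := by omega
    rcases this with h | h
    · obtain ⟨x, hx⟩ := W_emod16 (3 * 2 * (2 * i + 1)) 6 4 h (by decide)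
      obtain ⟨y, hy⟩ := W_emod16 (3 * 2 * (2 * i + 1) + 1) 7 5 (by omega) (by decide)
      obtain ⟨z, hz⟩ := W_emod16 (3 * 2 * (2 * i + 1) - 1) 5 3 (by omega) (by decide)
      refine ⟨1 + 4 * x, 2 * y, - 1 - 2 * z, 1 + 3 * y + 5 * z + 16 * y * z, ?_, ?_, ?_, ?_⟩
      · rw [hx]; ring
      · rw [hy]; ring
      · rw [hz]; ring
      · rw [hy, hz]; ring
    · obtain ⟨x, hx⟩ := W_emod16 (3 * 2 * (2 * i + 1)) 18 12 h (by decide)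
      obtain ⟨y, hy⟩ := W_emod16 (3 * 2 * (2 * i + 1) + 1) 19 13 (by omega) (by decide)
      obtain ⟨z, hz⟩ := W_emod16 (3 * 2 * (2 * i + 1) - 1) 17 11 (by omega) (by decide)
      refine ⟨3 + 4 * x, 1 + 2 * y, - 2 - 2 * z, 9 + 11 * y + 13 * z + 16 * y * z, ?_, ?_, ?_, ?_⟩
      · rw [hx]; ring
      · rw [hy]; ring
      · rw [hz]; ring
      · rw [hy, hz]; ring
  | succ e ih =>
    obtain ⟨a, b, c, d, h1, h2, h3, h4⟩ := ih
    have hj1 : 1 ≤ j := hj.pos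
    obtain ⟨t, ht⟩ : ∃ t, 3 * 2 ^ (e + 1) * j = t + 6 := by
      have : 6 ≤ 3 * 2 ^ (e + 1) * j := by
        have : 1 ≤ 2 ^ e * j := Nat.one_le_iff_ne_zero.2 (by positivity)
        rw [pow_succ]
        nlinarith
      exact ⟨_, (Nat.sub_add_cancel this).symm⟩
    have h3t : 3 ∣ t := by
      have : 3 ∣ t + 6 := by rw [← ht, mul_assoc]; exact dvd_mul_right _ _
      omega
    have hT : 3 * 2 ^ (e + 1 + 1) * j = 2 * (t + 6) := by rw [← ht]; ring
    have hE : (2 : ℤ) ^ (e + 1 + 1) = 2 * 2 ^ (e + 1) := by ring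
    have hE' : (2 : ℤ) ^ (e + 1) = 2 * 2 ^ e := by ring
    rw [hT, hE]
    rw [ht] at h1 h2 h3 h4
    rw [show t + 6 + 1 = t + 7 by ring] at h2 h4
    rw [show t + 6 - 1 = t + 5 by omega] at h3 h4
    have e0 := W_even (t + 3)
    have e1 := W_odd (t + 4)
    have e2 := W_odd (t + 3)
    simp only [add_assoc] at e0 e1 e2
    norm_num at e0 e1 e2
    rw [show 2 * (t + 6) - 1 = 2 * (t + 5) + 1 by omega]
    have odd : ∀ n, ¬ 3 ∣ n → ∃ u, W n = 2 * u + 1 := by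
      intro n hn
      rw [← W_even_iff, Int.not_even_iff_odd] at hn
      exact hn
    obtain ⟨u5, hu5⟩ := odd (t + 5) (by omega)
    obtain ⟨u7, hu7⟩ := odd (t + 7) (by omega)
    obtain ⟨u8, hu8⟩ := odd (t + 8) (by omega)
    obtain ⟨u4, hu4⟩ := odd (t + 4) (by omega)
    generalize (2 : ℤ) ^ (e + 1) = E at *
    generalize (2 : ℤ) ^ e = F at *
    have k1 : W (2 * (t + 6) + 1) = W (t + 8) * (8 * E ^ 3 * a ^ 3) -
        (-1 + 8 * E * d) * (1 + 2 * E + 4 * E * b) ^ 2 := by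
      rw [e1, ← h4, h1, ← h2]; ring
    have k2 : W (2 * (t + 5) + 1) = (-1 + 8 * E * d) * (1 + 2 * E + 4 * E * c) ^ 2 -
        W (t + 4) * (8 * E ^ 3 * a ^ 3) := by
      rw [e2, ← h4, h1]
      have : (1 + 2 * E + 4 * E * c) ^ 2 = W (t + 5) ^ 2 := by rw [h3]; ring
      rw [this]; ring
    have k12 : ∃ z, W (2 * (t + 6) + 1) * W (2 * (t + 5) + 1) =
        - (-1 + 8 * E * d) ^ 4 + 8 * E ^ 3 * z := by
      refine ⟨W (t + 8) * a ^ 3 * W (2 * (t + 5) + 1) +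
        (-1 + 8 * E * d) * (1 + 2 * E + 4 * E * b) ^ 2 * W (t + 4) * a ^ 3, ?_⟩
      have h5 : (-1 + 8 * E * d) ^ 2 =
          (1 + 2 * E + 4 * E * b) ^ 2 * (1 + 2 * E + 4 * E * c) ^ 2 := by
        rw [← h4, h2, h3]; ring
      have : (-1 + 8 * E * d) ^ 4 = (-1 + 8 * E * d) ^ 2 *
        ((1 + 2 * E + 4 * E * b) ^ 2 * (1 + 2 * E + 4 * E * c) ^ 2) := by rw [← h5]; ring
      rw [this, k1, k2]
      ring
    obtain ⟨z, hz⟩ := k12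
    refine ⟨a * (u5 ^ 2 * 4 * u8 + u5 ^ 2 * 2 + u5 * 4 * u8 + 2 * u5 + u8
        - (u7 ^ 2 * 4 * u4 + u7 ^ 2 * 2 + u7 * 4 * u4 + 2 * u7 + u4)),
      W (t + 8) * E ^ 2 * a ^ 3 - d * (1 + 2 * E + 4 * E * b) ^ 2 + F * (1 + 2 * b) ^ 2 + b,
      W (t + 4) * E ^ 2 * a ^ 3 - d * (1 + 2 * E + 4 * E * c) ^ 2 + F * (1 + 2 * c) ^ 2 + c,
      2 * d - 24 * E * d ^ 2 + 128 * E ^ 2 * d ^ 3 - 256 * E ^ 3 * d ^ 4 + F * E * z, ?_, ?_, ?_, ?_⟩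
    · rw [e0, h1, hu5, hu7, hu8, hu4]; ring
    · rw [k1, hE']; ring
    · rw [k2, hE']; ring
    · rw [hz, hE']; ring

theorem W_eq_pm_one (n : ℕ) (hn : 1 ≤ n) (h : W n = 1 ∨ W n = -1) : n = 1 ∨ n = 2 := by
  induction n using Nat.strong_induction_on with
  | _ n ih =>
  have h3 : ¬ 3 ∣ n := by
    intro h3
    have := (W_even_iff n).2 h3
    rcases h with h | h <;> rw [h] at this <;> exact absurd this (by decide)
  have h2 : ∀ e j, Odd j → W (3 * 2 ^ (e + 1) * j + 1) ≠ 1 ∧ W (3 * 2 ^ (e + 1) * j + 1) ≠ -1 ∧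
      W (3 * 2 ^ (e + 1) * j - 1) ≠ 1 ∧ W (3 * 2 ^ (e + 1) * j - 1) ≠ -1 := by
    intro e j hj
    obtain ⟨a, b, c, d, -, h2, h3, -⟩ := claimA e j hj
    rw [h2, h3]
    have hE : (2 : ℤ) ^ (e + 1) = 2 * 2 ^ e := by ring
    have hpos : (0 : ℤ) < 2 ^ e := by positivity
    rw [hE]
    generalize (2 : ℤ) ^ e = F at *
    have k1 : ∀ b : ℤ, 2 * (2 * F) + 4 * (2 * F) * b ≠ 0 := by
      intro b hb
      have : F * (4 + 8 * b) = 0 := by linarith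
      rcases mul_eq_zero.1 this with h | h
      · lia
      · lia
    have k2 : ∀ b : ℤ, 2 + 2 * (2 * F) + 4 * (2 * F) * b ≠ 0 := by
      intro b hb
      have : 4 * (F + 2 * (F * b)) = -2 := by linarith
      lia
    refine ⟨fun h => k1 b (by linarith), fun h => k2 b (by linarith), fun h => k2 c (by linarith),
      fun h => k1 c (by linarith)⟩
  have hT : ∀ i, 1 ≤ i → ∃ e j, Odd j ∧ 6 * i = 3 * 2 ^ (e + 1) * j := by
    intro i hi
    obtain ⟨e, j, hj, hij⟩ := Nat.exists_eq_two_pow_mul_odd (n := i) (by omega)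
    exact ⟨e, j, hj, by rw [hij]; ring⟩
  have : n % 6 = 1 ∨ n % 6 = 5 ∨ n % 2 = 0 := by omega
  rcases this with h6 | h6 | h6
  · by_cases h1 : n = 1
    · exact Or.inl h1
    obtain ⟨e, j, hj, hij⟩ := hT (n / 6) (by omega)
    have := h2 e j hj
    rw [← hij, show 6 * (n / 6) + 1 = n by omega] at this
    tauto
  · obtain ⟨e, j, hj, hij⟩ := hT (n / 6 + 1) (by omega)
    have := h2 e j hj
    rw [← hij, show 6 * (n / 6 + 1) - 1 = n by omega] at this
    tauto
  · have hd : W (n / 2) ∣ W n := by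
      have := normEDS_dvd_normEDS_two_mul (1 : ℤ) (-6) (-37) ((n / 2 : ℕ) : ℤ)
      have e : (2 : ℤ) * ((n / 2 : ℕ) : ℤ) = (n : ℤ) := by omega
      rw [e] at this
      exact this
    have hu : IsUnit (W (n / 2)) := by
      apply isUnit_of_dvd_unit hd
      rw [Int.isUnit_iff]; exact h
    rcases ih (n / 2) (by omega) (by omega) (Int.isUnit_iff.1 hu) with h1 | h1
    · right; omega
    · have : n = 4 := by omega
      rw [this, W4] at h
      norm_num at h

end P3

namespace P3

/-- rational elliptic sequence -/
def wseq (e : ℕ → ℚ) : ℕ → ℚ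
  | 0 => 0
  | 1 => 1
  | 2 => 1
  | (n + 3) => e (n + 2) * wseq e (n + 2) ^ 2 / wseq e (n + 1)

section
variable (e : ℕ → ℚ) (e1 : e 1 = 0) (e2 : e 2 = -6) (e3 : e 3 = -37 / 36)
  (hne : ∀ n, 2 ≤ n → e n ≠ 0)
  (hmul : ∀ n, e (n + 1) * e (n + 2) ^ 2 * e (n + 3) = e (n + 2) + 6)
  (hadd : ∀ n, e (n + 2) ^ 2 * (e (n + 3) + e (n + 1)) + 1 = 6 * e (n + 2))

include hne in
lemma wseq_ne (n : ℕ) : wseq e (n + 1) ≠ 0 := by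
  induction n using Nat.strong_induction_on with
  | _ n ih =>
    match n with
    | 0 => simp [wseq]
    | 1 => simp [wseq]
    | (k + 2) =>
      rw [wseq]
      have h1 := ih k (by omega)
      have h2 := ih (k + 1) (by omega)
      have h3 := hne (k + 2) (by omega)
      positivity

include hne e1 in
lemma rel1 (m : ℕ) : wseq e (m + 2) * wseq e m = wseq e (m + 1) ^ 2 * e (m + 1) := by
  match m with
  | 0 => simp [wseq, e1]
  | (k + 1) =>
    have := wseq_ne e hne k
    rw [wseq]
    field_simp

include hne e1 e2 hmul in
lemma rel2 (m : ℕ) : wseq e (m + 4) * wseq e m = wseq e (m + 2) ^ 2 * (e (m + 2) + 6) := by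
  match m with
  | 0 => simp [wseq, e2]
  | (k + 1) =>
    have h1 := wseq_ne e hne (k + 2)
    have r1 := rel1 e e1 hne (k + 1)
    have r2 := rel1 e e1 hne (k + 2)
    have r3 := rel1 e e1 hne (k + 3)
    have hm := hmul (k + 1)
    simp only [add_assoc] at *
    norm_num at *
    have h2 : wseq e (k + 3) ^ 2 ≠ 0 := pow_ne_zero _ h1
    apply mul_left_cancel₀ h2
    rw [← hm]
    linear_combination wseq e (k + 3) * wseq e (k + 1) * r3 +
      wseq e (k + 4) ^ 2 * e (k + 4) * r1 +
      e (k + 4) * e (k + 2) * (wseq e (k + 4) * wseq e (k + 2) + wseq e (k + 3) ^ 2 * e (k + 3)) * r2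

include hne e1 e2 hmul hadd in
lemma relmn (n : ℕ) : (∀ d, wseq e (d + n + 1 + (n + 1)) * wseq e d =
      wseq e (d + n + 1) ^ 2 * wseq e (n + 1) ^ 2 * (e (d + n + 1) - e (n + 1))) ∧
    (∀ d, wseq e (d + n + 2 + (n + 2)) * wseq e d =
      wseq e (d + n + 2) ^ 2 * wseq e (n + 2) ^ 2 * (e (d + n + 2) - e (n + 2))) := by
  induction n with
  | zero =>
    constructor
    · intro d
      have := rel1 e e1 hne d
      simp only [add_zero, zero_add, e1, sub_zero]
      rw [show d + 1 + 1 = d + 2 by ring, this]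
      simp [wseq]
    · intro d
      have := rel2 e e1 e2 hne hmul d
      simp only [add_zero, zero_add, e2]
      rw [show d + 2 + 2 = d + 4 by ring, this]
      simp [wseq]
  | succ n ih =>
    obtain ⟨ih1, ih2⟩ := ih
    refine ⟨fun d => ?_, ?_⟩
    · have := ih2 d
      rw [show d + (n + 1) + 1 = d + n + 2 by ring, show n + 1 + 1 = n + 2 by ring]
      exact this
    · intro d
      -- target: index n+3, m = d+n+3
      match d with
      | 0 => simp [wseq]
      | (d + 1) =>
      have a1 := ih2 (d + 3)
      have a2 := ih2 (d + 1)
      have a3 := ih1 (d + 3)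
      have nz1 := wseq_ne e hne (d + 2)
      have nz2 := wseq_ne e hne (d + 2 * n + 4)
      have s1 := rel1 e e1 hne (d + n + 3)
      have s2 := rel1 e e1 hne (n + 1)
      have q1 := hmul (d + n + 2)
      have q2 := hadd (d + n + 2)
      have q3 := hmul n
      have q4 := hadd n
      rw [show d + 3 + n + 2 + (n + 2) = d + 2 * n + 7 by ring, show d + 3 + n + 2 = d + n + 5 by ring] at a1
      rw [show d + 1 + n + 2 + (n + 2) = d + 2 * n + 5 by ring, show d + 1 + n + 2 = d + n + 3 by ring] at a2
      rw [show d + 3 + n + 1 + (n + 1) = d + 2 * n + 5 by ring, show d + 3 + n + 1 = d + n + 4 by ring] at a3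
      rw [show d + 1 + (n + 1) + 2 + (n + 1 + 2) = d + 2 * n + 7 by ring, show d + 1 + (n + 1) + 2 = d + n + 4 by ring,
        show n + 1 + 2 = n + 3 by ring]
      rw [show d + 2 + 1 = d + 3 by ring] at nz1
      rw [show d + 2 * n + 4 + 1 = d + 2 * n + 5 by ring] at nz2
      rw [show d + n + 3 + 2 = d + n + 5 by ring, show d + n + 3 + 1 = d + n + 4 by ring] at s1
      rw [show n + 1 + 2 = n + 3 by ring, show n + 1 + 1 = n + 2 by ring] at s2
      rw [show d + n + 2 + 1 = d + n + 3 by ring, show d + n + 2 + 2 = d + n + 4 by ring,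
        show d + n + 2 + 3 = d + n + 5 by ring] at q1 q2
      have nz : wseq e (d + 2 * n + 5) * wseq e (d + 3) ≠ 0 := mul_ne_zero nz2 nz1
      apply mul_left_cancel₀ nz
      have key : e (d + n + 4) ^ 2 * ((e (d + n + 5) - e (n + 2)) * (e (d + n + 3) - e (n + 2))) =
          e (n + 2) ^ 2 * ((e (d + n + 4) - e (n + 3)) * (e (d + n + 4) - e (n + 1))) := by
        linear_combination q1 - e (n + 2) * q2 - q3 + e (d + n + 4) * q4
      generalize wseq e (d + 2 * n + 7) = A at *
      generalize wseq e (d + 2 * n + 5) = B at *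
      generalize wseq e (d + 3) = C at *
      generalize wseq e (d + 1) = D at *
      generalize wseq e (d + n + 3) = p3 at *
      generalize wseq e (d + n + 4) = p4 at *
      generalize wseq e (d + n + 5) = p5 at *
      generalize wseq e (n + 1) = w1 at *
      generalize wseq e (n + 2) = w2 at *
      generalize wseq e (n + 3) = w3 at *
      generalize e (d + n + 3) = x3 at *
      generalize e (d + n + 4) = x4 at *
      generalize e (d + n + 5) = x5 at *
      generalize e (n + 1) = y1 at *
      generalize e (n + 2) = y2 at *
      generalize e (n + 3) = y3 at *
      calc B * C * (A * D) = (A * C) * (B * D) := by ring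
        _ = (p5 ^ 2 * w2 ^ 2 * (x5 - y2)) * (p3 ^ 2 * w2 ^ 2 * (x3 - y2)) := by rw [a1, a2]
        _ = (p5 * p3) ^ 2 * w2 ^ 4 * ((x5 - y2) * (x3 - y2)) := by ring
        _ = p4 ^ 4 * w2 ^ 4 * (x4 ^ 2 * ((x5 - y2) * (x3 - y2))) := by rw [s1]; ring
        _ = p4 ^ 4 * (w2 ^ 2 * y2) ^ 2 * ((x4 - y3) * (x4 - y1)) := by rw [key]; ring
        _ = p4 ^ 4 * (w3 * w1) ^ 2 * ((x4 - y3) * (x4 - y1)) := by rw [s2]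
        _ = (p4 ^ 2 * w1 ^ 2 * (x4 - y1)) * (p4 ^ 2 * w3 ^ 2 * (x4 - y3)) := by ring
        _ = B * C * (p4 ^ 2 * w3 ^ 2 * (x4 - y3)) := by rw [a3]

include hne e1 e2 e3 hmul hadd in
lemma wseq_eq_W (n : ℕ) : wseq e n = (W n : ℚ) := by
  have h3 : wseq e 3 = -6 := by simp [wseq, e2]
  have h4 : wseq e 4 = -37 := by
    rw [wseq, h3, e3]; simp [wseq]; norm_num
  have R := relmn e e1 e2 hne hmul hadd
  have S := rel1 e e1 hne
  induction n using normEDSRec with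
  | zero => simp [W0, wseq]
  | one => simp [W1, wseq]
  | two => simp [W2, wseq]
  | three => rw [h3, W3]; norm_num
  | four => rw [h4, W4]; norm_num
  | even m i1 i2 i3 i4 i5 =>
    rw [W_even]
    push_cast
    rw [← i1, ← i2, ← i3, ← i4, ← i5]
    have := (R m).2 2
    rw [show 2 + m + 2 + (m + 2) = 2 * (m + 3) by ring, show 2 + m + 2 = m + 4 by ring] at this
    have w2 : wseq e 2 = 1 := by simp [wseq]
    rw [w2, mul_one] at this
    rw [this]
    have s1 := S (m + 1)
    have s3 := S (m + 3)
    simp only [add_assoc] at s1 s3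
    norm_num at s1 s3
    linear_combination wseq e (m + 4) ^ 2 * s1 - wseq e (m + 2) ^ 2 * s3
  | odd m i1 i2 i3 i4 =>
    rw [W_odd]
    push_cast
    rw [← i1, ← i2, ← i3, ← i4]
    have := (R m).2 1
    rw [show 1 + m + 2 + (m + 2) = 2 * (m + 2) + 1 by ring, show 1 + m + 2 = m + 3 by ring] at this
    have w2 : wseq e 1 = 1 := by simp [wseq]
    rw [w2, mul_one] at this
    rw [this]
    have s1 := S (m + 1)
    have s2 := S (m + 2)
    simp only [add_assoc] at s1 s2
    norm_num at s1 s2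
    linear_combination wseq e (m + 3) ^ 2 * s1 - wseq e (m + 2) ^ 2 * s2

include hne e1 e2 e3 hmul hadd in
lemma W_e (n : ℕ) : (W (n + 2) : ℚ) * W n = W (n + 1) ^ 2 * e (n + 1) := by
  simp only [← wseq_eq_W e e1 e2 e3 hne hmul hadd]
  exact rel1 e e1 hne n

include hne e1 e2 e3 hmul hadd in
lemma W_somos (n : ℕ) : W (n + 4) * W n = W (n + 3) * W (n + 1) + 6 * W (n + 2) ^ 2 := by
  have h : (W (n + 4) : ℚ) * W n = W (n + 3) * W (n + 1) + 6 * W (n + 2) ^ 2 := by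
    simp only [← wseq_eq_W e e1 e2 e3 hne hmul hadd]
    have r1 := rel1 e e1 hne (n + 1)
    have r2 := rel2 e e1 e2 hne hmul n
    simp only [add_assoc] at r1
    norm_num at r1
    rw [r2, r1]; ring
  exact_mod_cast h

include hne e1 e2 e3 hmul hadd in
lemma W_coprime (n : ℕ) (p : ℤ) (hp : Prime p) (h1 : p ∣ W n) (h2 : p ∣ W (n + 1)) : False := by
  have hnu := hp.not_isUnit
  induction n using Nat.strong_induction_on with
  | _ n ih =>
  match n with
  | 0 => rw [W1] at h2; exact hnu (isUnit_of_dvd_one h2)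
  | 1 => rw [W1] at h1; exact hnu (isUnit_of_dvd_one h1)
  | 2 => rw [W2] at h1; exact hnu (isUnit_of_dvd_one h1)
  | (k + 3) =>
    have s := W_somos e e1 e2 e3 hne hmul hadd k
    rw [show k + 3 + 1 = k + 4 by ring] at h2
    have h6 : p ∣ 6 * W (k + 2) ^ 2 := by
      have : 6 * W (k + 2) ^ 2 = W (k + 4) * W k - W (k + 3) * W (k + 1) := by rw [s]; ring
      rw [this]
      exact dvd_sub (h2.mul_right _) (h1.mul_right _)
    rcases hp.dvd_or_dvd h6 with h | h
    · have : p ∣ 2 * 3 := by norm_num; exact h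
      rcases hp.dvd_or_dvd this with h | h
      · have ha : Associated p 2 := hp.associated_of_dvd Int.prime_two h
        exact W_mod2_ne (k + 3) ⟨ha.symm.dvd.trans h1, ha.symm.dvd.trans h2⟩
      · have ha : Associated p 3 := hp.associated_of_dvd Int.prime_three h
        exact W_mod3_ne (k + 3) ⟨ha.symm.dvd.trans h1, ha.symm.dvd.trans h2⟩
    · exact ih (k + 2) (by omega) (hp.dvd_of_dvd_pow h) h1

include hne e1 e2 e3 hmul hadd in
theorem e_integral (n : ℕ) (hn : 1 ≤ n) (z : ℤ) (hz : e n = z) : n = 1 ∨ n = 2 := by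
  obtain ⟨k, rfl⟩ : ∃ k, n = k + 1 := ⟨n - 1, by omega⟩
  have h := W_e e e1 e2 e3 hne hmul hadd k
  rw [hz] at h
  have h' : W (k + 2) * W k = W (k + 1) ^ 2 * z := by exact_mod_cast h
  have hu : IsUnit (W (k + 1)) := by
    by_contra hnu
    have h0 : W (k + 1) ≠ 0 := by
      have := wseq_ne e hne k
      rw [wseq_eq_W e e1 e2 e3 hne hmul hadd] at this
      exact_mod_cast this
    obtain ⟨p, hp, hpd⟩ := WfDvdMonoid.exists_irreducible_factor hnu h0
    have hpp := hp.prime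
    have : p ∣ W (k + 2) * W k := by
      rw [h']; exact (hpd.trans (dvd_pow_self _ two_ne_zero)).mul_right _
    rcases hpp.dvd_or_dvd this with hh | hh
    · exact W_coprime e e1 e2 e3 hne hmul hadd (k + 1) p hpp hpd hh
    · exact W_coprime e e1 e2 e3 hne hmul hadd k p hpp hh hpd
  exact W_eq_pm_one (k + 1) (by omega) (Int.isUnit_iff.1 hu)
end

end P3

namespace P3

/-- the curve `y² + y = x³ - 1` -/
abbrev EC : WeierstrassCurve.Affine ℚ := ⟨0, 0, 1, 0, -1⟩

abbrev Pt := EC.Point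

/-- `R` is the affine point `(x, y)` -/
def Is (R : Pt) (x y : ℚ) : Prop := ∃ h, R = WeierstrassCurve.Affine.Point.some x y h

lemma Is.eqn {R : Pt} {x y : ℚ} (h : Is R x y) : y ^ 2 + y = x ^ 3 - 1 := by
  obtain ⟨h, -⟩ := h
  have := (WeierstrassCurve.Affine.equation_iff (W := EC) x y).1 h.1
  simp at this
  linarith

lemma cube_ne {r : ℚ} : r ^ 3 ≠ 6 := by
  intro h
  have hd : r.den ^ 3 = 1 := by
    rw [← Rat.den_pow, h]; rfl
  have hd1 : r.den = 1 := by
    simpa using hd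
  have hr : r = r.num := by
    conv_lhs => rw [← Rat.num_div_den r, hd1]
    simp
  rw [hr] at h
  have h' : r.num ^ 3 = 6 := by exact_mod_cast h
  have h1 : 1 < r.num := by
    by_contra hh
    have : r.num ≤ 1 := by lia
    nlinarith [sq_nonneg r.num, sq_nonneg (r.num - 1), sq_nonneg (r.num + 1)]
  have h2 : r.num < 2 := by
    by_contra hh
    have : 2 ≤ r.num := by lia
    nlinarith [sq_nonneg r.num, mul_self_nonneg (r.num - 2)]
  lia

lemma no_two_torsion {x y : ℚ} (h : y ^ 2 + y = x ^ 3 - 1) : 2 * y + 1 ≠ 0 := by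
  intro h0
  apply cube_ne (r := 2 * x)
  linear_combination -8 * h + 2 * (2 * y + 1) * h0

lemma exists_Is {x y : ℚ} (h : y ^ 2 + y = x ^ 3 - 1) : ∃ R : Pt, Is R x y := by
  have hn : EC.Nonsingular x y := by
    rw [WeierstrassCurve.Affine.nonsingular_iff']
    refine ⟨?_, Or.inr ?_⟩
    · rw [WeierstrassCurve.Affine.equation_iff]
      simp
      linarith
    · simpa using no_two_torsion h
  exact ⟨_, hn, rfl⟩

lemma Is_of_ne {R : Pt} (h : R ≠ 0) : ∃ x y, Is R x y := by
  match R with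
  | .zero => exact absurd rfl h
  | .some x y hh => exact ⟨x, y, hh, rfl⟩

lemma Is.ne_zero {R : Pt} {x y : ℚ} (h : Is R x y) : R ≠ 0 := by
  obtain ⟨h, rfl⟩ := h
  exact WeierstrassCurve.Affine.Point.some_ne_zero h

lemma Is.inj {R : Pt} {x y x' y' : ℚ} (h : Is R x y) (h' : Is R x' y') : x = x' ∧ y = y' := by
  obtain ⟨h, rfl⟩ := h
  obtain ⟨h', e⟩ := h'
  simpa using e

lemma Is.eq_of {R S : Pt} {x y : ℚ} (h : Is R x y) (h' : Is S x y) : R = S := by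
  obtain ⟨h, rfl⟩ := h
  obtain ⟨h', rfl⟩ := h'
  rfl

lemma Is.neg {R : Pt} {x y : ℚ} (h : Is R x y) : Is (-R) x (-1 - y) := by
  obtain ⟨h, rfl⟩ := h
  rw [WeierstrassCurve.Affine.Point.neg_some]
  have : EC.negY x y = -1 - y := by simp [WeierstrassCurve.Affine.negY]; ring
  simp only [this]
  exact ⟨_, rfl⟩

lemma Is.eq_or_neg {R S : Pt} {x y y' : ℚ} (h : Is R x y) (h' : Is S x y') : R = S ∨ R = -S := by
  obtain ⟨h, rfl⟩ := h
  obtain ⟨h', rfl⟩ := h'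
  exact WeierstrassCurve.Affine.Point.X_eq_iff.1 rfl

lemma Is.add {R S : Pt} {x y x' y' : ℚ} (h : Is R x y) (h' : Is S x' y') (hx : x ≠ x')
    (l : ℚ) (hl : l * (x - x') = y - y') :
    Is (R + S) (l ^ 2 - x - x') (-1 - (l * (l ^ 2 - x - x' - x) + y)) := by
  obtain ⟨h, rfl⟩ := h
  obtain ⟨h', rfl⟩ := h'
  rw [WeierstrassCurve.Affine.Point.add_of_X_ne hx]
  have hs : EC.slope x x' y y' = l := by
    rw [WeierstrassCurve.Affine.slope_of_X_ne hx, div_eq_iff (sub_ne_zero.2 hx), hl]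
  have h1 : EC.addX x x' l = l ^ 2 - x - x' := by
    simp [WeierstrassCurve.Affine.addX]
  have h2 : EC.addY x x' y l = (-1 - (l * (l ^ 2 - x - x' - x) + y)) := by
    simp [WeierstrassCurve.Affine.addY, WeierstrassCurve.Affine.negAddY,
      WeierstrassCurve.Affine.negY, h1]
    ring
  simp only [hs, h1, h2]
  exact ⟨_, rfl⟩

lemma Is.dbl {R : Pt} {x y : ℚ} (h : Is R x y)
    (l : ℚ) (hl : l * (2 * y + 1) = 3 * x ^ 2) :
    Is (R + R) (l ^ 2 - x - x) (-1 - (l * (l ^ 2 - x - x - x) + y)) := by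
  have ht := no_two_torsion h.eqn
  obtain ⟨h, rfl⟩ := h
  have hy : y ≠ EC.negY x y := by
    simp [WeierstrassCurve.Affine.negY]
    intro hh; apply ht; linarith
  rw [WeierstrassCurve.Affine.Point.add_self_of_Y_ne hy]
  have hs : EC.slope x x y y = l := by
    rw [WeierstrassCurve.Affine.slope_of_Y_ne rfl hy]
    have e1 : y - EC.negY x y = 2 * y + 1 := by
      simp [WeierstrassCurve.Affine.negY]; ring
    rw [e1, div_eq_iff ht, hl]
    simp
  have h1 : EC.addX x x l = l ^ 2 - x - x := by
    simp [WeierstrassCurve.Affine.addX]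
  have h2 : EC.addY x x y l = (-1 - (l * (l ^ 2 - x - x - x) + y)) := by
    simp [WeierstrassCurve.Affine.addY, WeierstrassCurve.Affine.negAddY,
      WeierstrassCurve.Affine.negY, h1]
    ring
  simp only [hs, h1, h2]
  exact ⟨_, rfl⟩

/-- the generator -/
noncomputable def PP : Pt := (exists_Is (x := 1) (y := 0) (by norm_num)).choose

lemma PP_is : Is PP 1 0 := (exists_Is (x := 1) (y := 0) (by norm_num)).choose_spec

lemma PP2_is : Is (PP + PP) 7 (-19) := by
  have := PP_is.dbl 3 (by norm_num)
  norm_num at this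
  exact this

lemma PP3_is : ∃ y, Is ((3 : ℕ) • PP) (73 / 36) y := by
  have := PP2_is.add PP_is (by norm_num) (-19 / 6) (by norm_num)
  have e : (3 : ℕ) • PP = PP + PP + PP := by abel
  rw [e]
  norm_num at this
  exact ⟨_, this⟩

lemma dbl_two_adic {R : Pt} {x y : ℚ} (h : Is R x y) (k : ℕ) (a b : ℤ) (ha : Odd a) (hb : Odd b)
    (hx : x * (4 ^ (k + 1) * b) = a) :
    ∃ (x' y' : ℚ) (a' b' : ℤ), Is (R + R) x' y' ∧ Odd a' ∧ Odd b' ∧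
      x' * (4 ^ (k + 2) * b') = a' := by
  have ht := no_two_torsion h.eqn
  have heq := h.eqn
  refine ⟨_, _, a ^ 4 + 6 * a * (4 ^ (k + 1) * b) ^ 3, b * (a ^ 3 - 48 * 64 ^ k * b ^ 3),
    h.dbl (3 * x ^ 2 / (2 * y + 1)) (by field_simp), ?_, ?_, ?_⟩
  · apply Odd.add_even (ha.pow)
    exact ((by decide : Even (6 : ℤ)).mul_right _).mul_right _
  · apply hb.mul
    apply Odd.sub_even (ha.pow)
    exact ((by decide : Even (48 : ℤ)).mul_right _).mul_right _
  · have hD : (2 * y + 1) ^ 2 = 4 * x ^ 3 - 3 := by linear_combination 4 * heq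
    have hne : 4 * x ^ 3 - 3 ≠ 0 := by rw [← hD]; exact pow_ne_zero 2 ht
    have e1 : (3 * x ^ 2 / (2 * y + 1)) ^ 2 - x - x = (x ^ 4 + 6 * x) / (4 * x ^ 3 - 3) := by
      rw [div_pow, hD, eq_div_iff hne, sub_mul, sub_mul, div_mul_cancel₀ _ hne]
      ring
    rw [e1]
    push_cast
    rw [← hx, div_mul_eq_mul_div, div_eq_iff hne]
    have e64 : (64 : ℚ) ^ k = (4 ^ k) ^ 3 := by rw [← pow_mul, mul_comm, pow_mul]; norm_num
    rw [e64, pow_succ, pow_succ]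
    ring

lemma two_adic (k : ℕ) : ∃ (x y : ℚ) (a b : ℤ), Is ((3 * 2 ^ k : ℕ) • PP) x y ∧ Odd a ∧ Odd b ∧
      x * (4 ^ (k + 1) * b) = a := by
  induction k with
  | zero =>
    obtain ⟨y, hy⟩ := PP3_is
    exact ⟨_, y, 73, 9, by simpa using hy, by decide, by decide, by norm_num⟩
  | succ k ih =>
    obtain ⟨x, y, a, b, h, ha, hb, hx⟩ := ih
    have := dbl_two_adic h k a b ha hb hx
    rw [← two_nsmul, ← mul_nsmul', show 2 * (3 * 2 ^ k) = 3 * 2 ^ (k + 1) by ring] at this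
    exact this

lemma two_adic_inj : Function.Injective (fun k : ℕ => (3 * 2 ^ k : ℕ) • PP) := by
  have key : ∀ k l : ℕ, k < l → (3 * 2 ^ k : ℕ) • PP ≠ (3 * 2 ^ l : ℕ) • PP := by
    intro k l hkl he
    obtain ⟨x, y, a, b, h, ha, hb, hx⟩ := two_adic k
    obtain ⟨x', y', a', b', h', ha', hb', hx'⟩ := two_adic l
    rw [he] at h
    obtain ⟨rfl, -⟩ := h.inj h'
    obtain ⟨d, rfl⟩ : ∃ d, l = k + 1 + d := ⟨l - k - 1, by omega⟩
    have e : a * (4 * (4 ^ d * b')) = a' * b := by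
      have : (a : ℚ) * (4 * (4 ^ d * b')) = a' * b := by
        rw [← hx, ← hx']; ring
      exact_mod_cast this
    have ho : Odd (a' * b) := ha'.mul hb
    rw [← e] at ho
    exact (Int.not_odd_iff_even.2 (((by decide : Even (4 : ℤ)).mul_right _).mul_left _)) ho
  intro k l h
  rcases lt_trichotomy k l with hh | hh | hh
  · exact absurd h (key k l hh)
  · exact hh
  · exact absurd h.symm (key l k hh)

lemma PP_inf : ¬ IsOfFinAddOrder PP := by
  intro h
  have hf : Finite (AddSubgroup.zmultiples PP) := finite_zmultiples.2 h
  let f : ℕ → AddSubgroup.zmultiples PP := fun k =>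
    ⟨(3 * 2 ^ k : ℕ) • PP, AddSubgroup.nsmul_mem_zmultiples PP _⟩
  have hf2 : Function.Injective f := by
    intro k l hkl
    apply two_adic_inj
    exact congrArg Subtype.val hkl
  exact not_injective_infinite_finite f hf2

lemma PP_nsmul_ne (n : ℕ) (hn : n ≠ 0) : n • PP ≠ 0 := by
  intro h
  exact PP_inf (isOfFinAddOrder_iff_nsmul_eq_zero.2 ⟨n, Nat.pos_of_ne_zero hn, h⟩)

/-- `x`-coordinate -/
def xc : Pt → ℚ
  | .zero => 0
  | .some x _ _ => x

lemma Is.xc {R : Pt} {x y : ℚ} (h : Is R x y) : xc R = x := by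
  obtain ⟨h, rfl⟩ := h
  rfl

lemma e_rec {R : Pt} {x y x1 y1 x2 y2 : ℚ} (h : Is R x y) (hx : x ≠ 1)
    (h1 : Is (R + PP) x1 y1) (h2 : Is (R - PP) x2 y2) :
    (1 - x2) * (1 - x) ^ 2 * (1 - x1) = (1 - x) + 6 ∧
    (1 - x) ^ 2 * ((1 - x1) + (1 - x2)) + 1 = 6 * (1 - x) := by
  have hx' : x - 1 ≠ 0 := sub_ne_zero.2 hx
  have a1 := (h.add PP_is hx (y / (x - 1)) (by field_simp; ring)).inj h1
  have a2 := h.add PP_is.neg hx ((y + 1) / (x - 1)) (by field_simp; ring)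
  rw [← sub_eq_add_neg] at a2
  have a2 := a2.inj h2
  have heq := h.eqn
  have hp : (1 - x1) * (x - 1) ^ 2 = (x + 2) * (x - 1) ^ 2 - y ^ 2 := by
    rw [← a1.1]; field_simp; ring
  have hm : (1 - x2) * (x - 1) ^ 2 = (x + 2) * (x - 1) ^ 2 - (y + 1) ^ 2 := by
    rw [← a2.1]; field_simp; ring
  constructor
  · apply mul_left_cancel₀ (pow_ne_zero 2 hx')
    have e : (x - 1) ^ 2 * ((1 - x2) * (1 - x) ^ 2 * (1 - x1)) =
        ((1 - x1) * (x - 1) ^ 2) * ((1 - x2) * (x - 1) ^ 2) := by ring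
    rw [e, hp, hm]
    linear_combination (y ^ 2 + y + x ^ 3 - 1 - 2 * ((x + 2) * (x - 1) ^ 2)) * heq
  · linear_combination hp + hm - 2 * heq

/-- integral points among multiples of `PP` -/
lemma integral_nsmul (n : ℕ) (hn : 1 ≤ n) (x y : ℚ) (h : Is (n • PP) x y) (z : ℤ) (hz : x = z) :
    x = 1 ∨ x = 7 := by
  have key : ∀ m : ℕ, 1 ≤ m → ∃ a b, Is (m • PP) a b := fun m hm =>
    Is_of_ne (PP_nsmul_ne m (by lia))
  have hne1 : ∀ m : ℕ, 2 ≤ m → ∀ a b, Is (m • PP) a b → a ≠ 1 := by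
    rintro m hm a b hab rfl
    rcases hab.eq_or_neg PP_is with e | e
    · apply PP_nsmul_ne (m - 1) (by lia)
      obtain ⟨t, rfl⟩ : ∃ t, m = t + 1 := ⟨m - 1, by lia⟩
      rw [succ_nsmul] at e
      simpa using e
    · apply PP_nsmul_ne (m + 1) (by lia)
      rw [succ_nsmul, e]; simp
  have P1 : Is ((1 : ℕ) • PP) 1 0 := by simpa using PP_is
  have P2 : Is ((2 : ℕ) • PP) 7 (-19) := by simpa [two_nsmul] using PP2_is
  have hrec : ∀ m : ℕ, (1 - xc ((m + 1) • PP)) * (1 - xc ((m + 2) • PP)) ^ 2 * (1 - xc ((m + 3) • PP)) =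
      (1 - xc ((m + 2) • PP)) + 6 ∧ (1 - xc ((m + 2) • PP)) ^ 2 *
      ((1 - xc ((m + 3) • PP)) + (1 - xc ((m + 1) • PP))) + 1 = 6 * (1 - xc ((m + 2) • PP)) := by
    intro m
    obtain ⟨a, b, h1⟩ := key (m + 1) (by lia)
    obtain ⟨a', b', h2⟩ := key (m + 2) (by lia)
    obtain ⟨a'', b'', h3⟩ := key (m + 3) (by lia)
    rw [h1.xc, h2.xc, h3.xc]
    apply e_rec h2 (hne1 _ (by lia) _ _ h2) (y1 := b'') (y2 := b)
    · rw [← succ_nsmul]; exact h3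
    · rw [succ_nsmul, add_sub_cancel_right]; exact h1
  have := e_integral (fun m => 1 - xc (m • PP)) (by simp only [P1.xc]; norm_num)
    (by simp only [P2.xc]; norm_num)
    (by obtain ⟨y, hy⟩ := PP3_is
        simp only [hy.xc]; norm_num)
    (by
      intro m hm
      obtain ⟨a, b, h1⟩ := key m (by lia)
      simp only [h1.xc]
      exact sub_ne_zero.2 (hne1 m hm a b h1).symm)
    (fun m => (hrec m).1) (fun m => (hrec m).2) n hn (1 - z)
    (by simp only [h.xc]; rw [hz]; push_cast; ring)
  rcases this with rfl | rfl
  · exact Or.inl (h.inj P1).1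
  · exact Or.inr (h.inj P2).1

lemma integral_zmultiples (R : Pt) (hR : R ∈ AddSubgroup.zmultiples PP) (x y : ℚ) (h : Is R x y)
    (z : ℤ) (hz : x = z) : x = 1 ∨ x = 7 := by
  obtain ⟨n, rfl⟩ := hR
  have h : Is (n • PP) x y := h
  rcases lt_trichotomy n 0 with hn | rfl | hn
  · have h' := h.neg
    rw [← neg_smul] at h'
    obtain ⟨t, ht⟩ : ∃ t : ℕ, -n = t := ⟨(-n).toNat, by lia⟩
    rw [ht, natCast_zsmul] at h'
    exact integral_nsmul t (by lia) _ _ h' z hz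
  · exact absurd (zero_smul ℤ PP) h.ne_zero
  · obtain ⟨t, ht⟩ : ∃ t : ℕ, n = t := ⟨n.toNat, by lia⟩
    rw [ht, natCast_zsmul] at h
    exact integral_nsmul t (by lia) _ _ h z hz

end P3

namespace P3

lemma triple {S : Pt} {x y : ℚ} (h : Is S x y) (hx : x ≠ 0) (hu : y + 2 ≠ 0) (hv : y - 1 ≠ 0) :
    ∃ y', Is (S + S + S) (((y + 2) ^ 6 - (y + 2) ^ 3 * (y - 1) ^ 3 + (y - 1) ^ 6) /
      (9 * x ^ 2 * ((y + 2) * (y - 1)) ^ 2)) y' := by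
  have heq := h.eqn
  have ht := no_two_torsion heq
  have h2 := h.dbl (3 * x ^ 2 / (2 * y + 1)) (by field_simp)
  set l := 3 * x ^ 2 / (2 * y + 1) with hl
  have hl' : l * (2 * y + 1) = 3 * x ^ 2 := by rw [hl]; field_simp
  set x2 := l ^ 2 - x - x with hx2
  have hx2' : (x2 - x) * (2 * y + 1) ^ 2 = - 3 * x * ((y + 2) * (y - 1)) := by
    rw [hx2]
    linear_combination (l * (2 * y + 1) + 3 * x ^ 2) * hl' - 9 * x * heq
  have hne : x2 - x ≠ 0 := by
    intro h0
    rw [h0, zero_mul] at hx2'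
    have : - 3 * x * ((y + 2) * (y - 1)) ≠ 0 :=
      mul_ne_zero (mul_ne_zero (by norm_num) hx) (mul_ne_zero hu hv)
    exact this hx2'.symm
  set y2 := -1 - (l * (x2 - x) + y) with hy2
  have hy2' : (y2 - y) * (2 * y + 1) ^ 3 = -(7 * (y ^ 2 + y) ^ 2 + 17 * (y ^ 2 + y) + 19) := by
    have e : (l * (x2 - x)) * (2 * y + 1) ^ 3 = -9 * x ^ 3 * ((y + 2) * (y - 1)) := by
      linear_combination (x2 - x) * (2 * y + 1) ^ 2 * hl' + 3 * x ^ 2 * hx2'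
    rw [hy2]
    linear_combination -e - 9 * ((y + 2) * (y - 1)) * heq
  have hl2 : ((7 * (y ^ 2 + y) ^ 2 + 17 * (y ^ 2 + y) + 19) / (3 * x * ((y + 2) * (y - 1)) * (2 * y + 1))) *
      (x2 - x) = y2 - y := by
    rw [div_mul_eq_mul_div, div_eq_iff (mul_ne_zero (mul_ne_zero (by simpa using hx) (mul_ne_zero hu hv)) ht)]
    apply mul_right_cancel₀ (pow_ne_zero 2 ht)
    linear_combination (7 * (y ^ 2 + y) ^ 2 + 17 * (y ^ 2 + y) + 19) * hx2' -
      3 * x * ((y + 2) * (y - 1)) * hy2'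
  have h3 := h2.add h (sub_ne_zero.1 hne) _ hl2
  refine ⟨_, cast (congrArg (fun t => Is (S + S + S) t _) ?_) h3⟩
  have hx2e : x2 + x = (5 * x ^ 4 + 3 * x) / (2 * y + 1) ^ 2 := by
    rw [eq_div_iff (pow_ne_zero 2 ht)]
    linear_combination hx2' + 5 * x * heq
  rw [sub_sub, hx2e, div_pow, div_sub_div _ _
    (pow_ne_zero 2 (mul_ne_zero (mul_ne_zero (by simpa using hx) (mul_ne_zero hu hv)) ht))
    (pow_ne_zero 2 ht), div_eq_div_iff
    (mul_ne_zero (pow_ne_zero 2 (mul_ne_zero (mul_ne_zero (by simpa using hx)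
      (mul_ne_zero hu hv)) ht)) (pow_ne_zero 2 ht))
    (mul_ne_zero (mul_ne_zero (by norm_num) (pow_ne_zero 2 hx))
      (pow_ne_zero 2 (mul_ne_zero hu hv)))]
  have key : (7 * (y ^ 2 + y) ^ 2 + 17 * (y ^ 2 + y) + 19) ^ 2 -
      9 * x ^ 2 * ((y + 2) * (y - 1)) ^ 2 * (5 * x ^ 4 + 3 * x) =
      (2 * y + 1) ^ 2 * ((y + 2) ^ 6 - (y + 2) ^ 3 * (y - 1) ^ 3 + (y - 1) ^ 6) := by
    linear_combination 9 * ((y + 2) * (y - 1)) ^ 2 * (5 * (x ^ 3 + y ^ 2 + y + 1) + 3) * heq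
  linear_combination (9 * x ^ 2 * ((y + 2) * (y - 1)) ^ 2 * (2 * y + 1) ^ 2) * key

lemma cubes3 {a b c t : ℤ} (hab : IsCoprime a b) (hac : IsCoprime a c) (hbc : IsCoprime b c)
    (h : a * b * c = t ^ 3) : ∃ u v w, a = u ^ 3 ∧ b = v ^ 3 ∧ c = w ^ 3 := by
  have o : Odd 3 := by decide
  obtain ⟨⟨d, hd⟩, ⟨w, hw⟩⟩ := Int.eq_pow_of_mul_eq_pow_odd (hac.mul_left hbc) o h
  obtain ⟨⟨u, hu⟩, ⟨v, hv⟩⟩ := Int.eq_pow_of_mul_eq_pow_odd hab o hd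
  exact ⟨u, v, w, hu, hv, hw⟩

lemma desc9 {a b c : ℤ} (hab : IsCoprime a b) (hc : c ≠ 0) (h : 3 * a * b * (a - b) = - c ^ 3)
    (hb : 9 ∣ b) : ∃ u v e n : ℤ, a = u ^ 3 ∧ a - b = v ^ 3 ∧ u - v = 3 * e ^ 3 ∧
      v ^ 2 + 3 * v * e ^ 3 + 3 * e ^ 6 = n ^ 3 ∧ c = - 3 * u * v * e * n ∧ IsCoprime u v := by
  obtain ⟨b, rfl⟩ := hb
  have h3 : (3 : ℤ) ∣ c := by
    apply Int.prime_three.dvd_of_dvd_pow (n := 3)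
    exact ⟨-(9 * a * b * (a - 9 * b)), by linear_combination h⟩
  obtain ⟨c, rfl⟩ := h3
  have h' : a * b * (a - 9 * b) = (-c) ^ 3 := by
    have : 27 * (a * b * (a - 9 * b)) = 27 * (-c) ^ 3 := by linear_combination h
    exact mul_left_cancel₀ (by norm_num) this
  have c1 : IsCoprime a b := hab.of_mul_right_right
  have c2 : IsCoprime a (a - 9 * b) := by
    rw [show a - 9 * b = -(9 * b) + a * 1 by ring]
    exact hab.neg_right.add_mul_left_right 1
  have c3 : IsCoprime b (a - 9 * b) := by
    rw [show a - 9 * b = a + b * (-9) by ring]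
    exact c1.symm.add_mul_left_right (-9)
  obtain ⟨u, w, v, rfl, rfl, hv⟩ := cubes3 c1 c2 c3 h'
  have cuv : IsCoprime u v := by
    rw [hv] at c2
    exact (IsCoprime.pow_iff (by norm_num) (by norm_num)).1 c2
  have hm : (3 : ℤ) ∣ u - v := by
    have e : u ^ 3 - v ^ 3 = 9 * w ^ 3 := by linarith
    apply Int.prime_three.dvd_of_dvd_pow (n := 3)
    exact ⟨3 * w ^ 3 - u * v * (u - v), by linear_combination e⟩
  obtain ⟨f, hf⟩ := hm
  obtain rfl : u = v + 3 * f := by linarith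
  have hw : f * (v ^ 2 + 3 * v * f + 3 * f ^ 2) = w ^ 3 := by
    have : 9 * (f * (v ^ 2 + 3 * v * f + 3 * f ^ 2)) = 9 * w ^ 3 := by linear_combination hv
    exact mul_left_cancel₀ (by norm_num) this
  have cfv : IsCoprime f v := by
    have : IsCoprime (3 * f) v := by
      rw [show 3 * f = v + 3 * f + (-1) * v by ring]
      exact cuv.add_mul_right_left (-1)
    exact this.of_mul_left_right
  have cfn : IsCoprime f (v ^ 2 + 3 * v * f + 3 * f ^ 2) := by
    rw [show v ^ 2 + 3 * v * f + 3 * f ^ 2 = v ^ 2 + f * (3 * v + 3 * f) by ring]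
    exact (cfv.pow_right (n := 2)).add_mul_left_right (3 * v + 3 * f)
  obtain ⟨⟨e, rfl⟩, ⟨n, hn⟩⟩ := Int.eq_pow_of_mul_eq_pow_odd cfn (by decide : Odd 3) hw
  refine ⟨_, v, e, n, rfl, hv, by ring, by rw [← hn]; ring, ?_, cuv⟩
  have hwen : w = e * n := by
    have : (e * n) ^ 3 = w ^ 3 := by rw [mul_pow, ← hn, hw]
    exact ((Odd.strictMono_pow (by decide : Odd 3)).injective this).symm
  have : (-c) ^ 3 = ((v + 3 * e ^ 3) * v * e * n) ^ 3 := by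
    rw [← h', hv, hwen]; ring
  have := (Odd.strictMono_pow (by decide : Odd 3)).injective this
  linarith

end P3

namespace P3

lemma nine {a b : ℤ} (hab : IsCoprime a b) (h9 : 9 ∣ a * b * (a - b)) (h3 : 3 ∣ b) : 9 ∣ b := by
  obtain ⟨t, ht⟩ := h3
  have c3 : IsCoprime (3 : ℤ) a := by
    rw [ht] at hab; exact hab.symm.of_mul_left_left
  have c3' : IsCoprime (3 : ℤ) (a - b) := by
    rw [ht, show a - 3 * t = a + 3 * (-t) by ring]
    exact c3.add_mul_left_right (-t)
  have c9 : IsCoprime (9 : ℤ) (a * (a - b)) := by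
    have := (c3.mul_right c3').pow_left (m := 2)
    norm_num at this
    exact this
  apply c9.dvd_of_dvd_mul_left
  rwa [show a * (a - b) * b = a * b * (a - b) by ring]

lemma rat_int {p q : ℚ} (h : 3 * p * q * (p - q) = -1) : ∃ a b c : ℤ, IsCoprime a b ∧ c ≠ 0 ∧
    p * c = a ∧ q * c = b ∧ 3 * a * b * (a - b) = - c ^ 3 := by
  obtain ⟨a0, b0, c0, hc0, hp0, hq0⟩ : ∃ a b c : ℤ, c ≠ 0 ∧ p * c = a ∧ q * c = b := by
    refine ⟨p.num * q.den, q.num * p.den, p.den * q.den, ?_, ?_, ?_⟩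
    · have := p.den_ne_zero; have := q.den_ne_zero; positivity
    · push_cast; rw [← mul_assoc, Rat.mul_den_eq_num]
    · push_cast; rw [mul_comm (p.den : ℚ), ← mul_assoc, Rat.mul_den_eq_num]
  have h0 : 3 * a0 * b0 * (a0 - b0) = - c0 ^ 3 := by
    have : (3 * a0 * b0 * (a0 - b0) : ℚ) = - c0 ^ 3 := by
      rw [← hp0, ← hq0]; linear_combination (c0 : ℚ) ^ 3 * h
    exact_mod_cast this
  have hb0 : b0 ≠ 0 := by
    rintro rfl
    apply hc0
    have : c0 ^ 3 = 0 := by linarith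
    simpa using this
  have hg : 0 < Int.gcd a0 b0 := Int.gcd_pos_of_ne_zero_right _ hb0
  obtain ⟨a, b, hab, ha, hb⟩ := Int.exists_gcd_one hg
  set g : ℤ := (Int.gcd a0 b0 : ℤ) with hgdef
  have hg0 : g ≠ 0 := by rw [hgdef]; exact_mod_cast hg.ne'
  have hgc : g ∣ c0 := by
    have : g ^ 3 ∣ c0 ^ 3 := ⟨-(3 * a * b * (a - b)), by rw [ha, hb] at h0; linear_combination h0⟩
    exact (Int.pow_dvd_pow_iff (by norm_num)).1 this
  obtain ⟨c, rfl⟩ := hgc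
  have hgq : (g : ℚ) ≠ 0 := by exact_mod_cast hg0
  refine ⟨a, b, c, Int.isCoprime_iff_gcd_eq_one.2 hab, right_ne_zero_of_mul hc0, ?_, ?_, ?_⟩
  · apply mul_right_cancel₀ hgq
    have : (a0 : ℚ) = a * g := by exact_mod_cast ha
    rw [← this, ← hp0]; push_cast; ring
  · apply mul_right_cancel₀ hgq
    have : (b0 : ℚ) = b * g := by exact_mod_cast hb
    rw [← this, ← hq0]; push_cast; ring
  · apply mul_right_cancel₀ (pow_ne_zero 3 hg0)
    rw [ha, hb] at h0
    linear_combination h0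

lemma rat_int9 {p q : ℚ} (h : 3 * p * q * (p - q) = -1) : ∃ a b c : ℤ, IsCoprime a b ∧ c ≠ 0 ∧
    (p ^ 2 - p * q + q ^ 2) * c ^ 2 = a ^ 2 - a * b + b ^ 2 ∧
    3 * a * b * (a - b) = - c ^ 3 ∧ 9 ∣ b := by
  obtain ⟨a, b, c, hab, hc, hp, hq, he⟩ := rat_int h
  have hK : (p ^ 2 - p * q + q ^ 2) * c ^ 2 = (a ^ 2 - a * b + b ^ 2 : ℚ) := by
    rw [← hp, ← hq]; ring
  have h3c : (3 : ℤ) ∣ c := by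
    apply Int.prime_three.dvd_of_dvd_pow (n := 3)
    exact ⟨-(a * b * (a - b)), by linear_combination he⟩
  have h9 : 9 ∣ a * b * (a - b) := by
    obtain ⟨t, rfl⟩ := h3c
    refine ⟨- t ^ 3, ?_⟩
    apply mul_left_cancel₀ (by norm_num : (3 : ℤ) ≠ 0)
    linear_combination he
  have hb_amb : IsCoprime b (a - b) := by
    rw [show a - b = a + b * (-1) by ring]
    exact hab.symm.add_mul_left_right _
  have ha_amb : IsCoprime a (a - b) := by
    rw [show a - b = -b + a * 1 by ring]
    exact hab.neg_right.add_mul_left_right _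
  have h3 : (3 : ℤ) ∣ a * b * (a - b) := dvd_trans (by norm_num) h9
  rcases Int.prime_three.dvd_or_dvd h3 with h3 | h3
  · rcases Int.prime_three.dvd_or_dvd h3 with h3 | h3
    · refine ⟨-(a - b), -a, c, ha_amb.symm.neg_neg, hc, ?_, ?_, nine ha_amb.symm.neg_neg ?_ ?_⟩
      · rw [hK]; push_cast; ring
      · linear_combination he
      · convert h9 using 1; ring
      · simpa using h3
    · exact ⟨a, b, c, hab, hc, hK, he, nine hab h9 h3⟩
  · refine ⟨-b, a - b, c, hb_amb.neg_left, hc, ?_, ?_, nine hb_amb.neg_left ?_ h3⟩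
    · rw [hK]; push_cast; ring
    · linear_combination he
    · convert h9 using 1; ring

lemma ineq6 (u v : ℤ) : (u ^ 2 + u * v + v ^ 2) ^ 3 ≤ 27 * (u ^ 6 - u ^ 3 * v ^ 3 + v ^ 6) := by
  nlinarith [sq_nonneg (u * v * (u - v)), mul_nonneg (sq_nonneg (u - v)) (sq_nonneg (u ^ 2 + u * v)), mul_nonneg (sq_nonneg (u - v)) (sq_nonneg (u ^ 2 - v ^ 2)), mul_nonneg (sq_nonneg (u - v)) (sq_nonneg (v ^ 2 + u * v)), mul_nonneg (sq_nonneg (u - v)) (sq_nonneg (u ^ 2 + u * v + v ^ 2)),mul_nonneg (sq_nonneg (u - v)) (sq_nonneg (u ^ 2)),mul_nonneg (sq_nonneg (u - v)) (sq_nonneg (v ^ 2))]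

lemma descent {R' : Pt} {x' y' p q : ℚ} (hR : Is R' x' y') (h3 : 3 * p * q * (p - q) = -1)
    (hx : x' = p ^ 2 - p * q + q ^ 2) (N D : ℤ) (hN : 0 < N) (hD : x' * D = N) :
    ∃ n e s : ℤ, e ≠ 0 ∧ IsCoprime s e ∧ s ^ 2 + s * e ^ 3 + e ^ 6 = n ^ 3 ∧ 0 < n ∧ n ^ 9 ≤ N ∧
      ∃ S : Pt, Is S (n / e ^ 2) (s / e ^ 3) ∧ (R' = S + S + S ∨ R' = -(S + S + S)) := by
  obtain ⟨a, b, c, hab, hc, hK, he, hb⟩ := rat_int9 h3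
  have hKN : a ^ 2 - a * b + b ^ 2 ≤ N := by
    apply Int.le_of_dvd hN
    have e : (a ^ 2 - a * b + b ^ 2) * D = N * c ^ 2 := by
      have : ((a ^ 2 - a * b + b ^ 2) * D : ℚ) = N * c ^ 2 := by
        rw [← hK, ← hD, hx]; ring
      exact_mod_cast this
    have hb_amb : IsCoprime b (a - b) := by
      rw [show a - b = a + b * (-1) by ring]
      exact hab.symm.add_mul_left_right _
    have ha_amb : IsCoprime a (a - b) := by
      rw [show a - b = -b + a * 1 by ring]
      exact hab.neg_right.add_mul_left_right _
    have k1 : IsCoprime a (a ^ 2 - a * b + b ^ 2) := by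
      rw [show a ^ 2 - a * b + b ^ 2 = b ^ 2 + a * (a - b) by ring]
      exact (hab.pow_right (n := 2)).add_mul_left_right _
    have k2 : IsCoprime b (a ^ 2 - a * b + b ^ 2) := by
      rw [show a ^ 2 - a * b + b ^ 2 = a ^ 2 + b * (b - a) by ring]
      exact (hab.symm.pow_right (n := 2)).add_mul_left_right _
    have k3 : IsCoprime (a - b) (a ^ 2 - a * b + b ^ 2) := by
      rw [show a ^ 2 - a * b + b ^ 2 = b ^ 2 + (a - b) * a by ring]
      exact (hb_amb.symm.pow_right (n := 2)).add_mul_left_right _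
    have k4 : IsCoprime 3 (a ^ 2 - a * b + b ^ 2) := by
      obtain ⟨t, ht⟩ := hb
      rw [ht, show (9 : ℤ) * t = 3 * (3 * t) by ring] at k2
      rw [ht, show (9 : ℤ) * t = 3 * (3 * t) by ring]
      exact k2.of_mul_left_left
    have kc : IsCoprime (c ^ 3) (a ^ 2 - a * b + b ^ 2) := by
      have := ((k4.mul_left k1).mul_left k2).mul_left k3
      rw [he] at this
      simpa using this.neg_left
    have kc2 : IsCoprime (c ^ 2) (a ^ 2 - a * b + b ^ 2) := by
      exact ((IsCoprime.pow_left_iff (by norm_num)).1 kc).pow_left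
    exact kc2.symm.dvd_of_dvd_mul_right ⟨D, e.symm⟩
  obtain ⟨u, v, e, n, hu, hv, huv, hn, hcc, cuv⟩ := desc9 hab hc he hb
  have hu0 : u ≠ 0 := by rintro rfl; apply hc; rw [hcc]; ring
  have hv0 : v ≠ 0 := by rintro rfl; apply hc; rw [hcc]; ring
  have he0 : e ≠ 0 := by rintro rfl; apply hc; rw [hcc]; ring
  have hn0 : n ≠ 0 := by rintro rfl; apply hc; rw [hcc]; ring
  have hK2 : a ^ 2 - a * b + b ^ 2 = u ^ 6 - u ^ 3 * v ^ 3 + v ^ 6 := by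
    have : b = u ^ 3 - v ^ 3 := by rw [← hv, ← hu]; ring
    rw [this, hu]; ring
  have hue : u = v + 3 * e ^ 3 := by linarith
  have hs3 : (v + e ^ 3) ^ 2 + (v + e ^ 3) * e ^ 3 + e ^ 6 = n ^ 3 := by rw [← hn]; ring
  have hnpos : 0 < n := by
    have : 0 < n ^ 3 := by
      rw [← hn]
      have : 0 < e ^ 6 := by positivity
      nlinarith [sq_nonneg (2 * v + 3 * e ^ 3)]
    exact (Odd.pow_pos_iff (by decide)).1 this
  have hcop : IsCoprime (v + e ^ 3) e := by
    have h1 : IsCoprime v (e ^ 3) := by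
      rw [hue] at cuv
      have := cuv.symm.add_mul_left_right (-1)
      rw [show v + 3 * e ^ 3 + v * -1 = 3 * e ^ 3 by ring] at this
      exact this.of_mul_right_right
    have h2 : IsCoprime v e := (IsCoprime.pow_right_iff (by norm_num)).1 h1
    rw [show v + e ^ 3 = v + e * e ^ 2 by ring]
    exact h2.add_mul_left_left _
  have he0' : (e : ℚ) ≠ 0 := by exact_mod_cast he0
  have hn0' : (n : ℚ) ≠ 0 := by exact_mod_cast hn0
  have hu0' : (u : ℚ) ≠ 0 := by exact_mod_cast hu0
  have hv0' : (v : ℚ) ≠ 0 := by exact_mod_cast hv0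
  have hc0' : (c : ℚ) ≠ 0 := by exact_mod_cast hc
  have hueq : (u : ℚ) = v + 3 * e ^ 3 := by exact_mod_cast hue
  obtain ⟨S, hS⟩ : ∃ S : Pt, Is S (n / e ^ 2) (((v + e ^ 3 : ℤ) : ℚ) / e ^ 3) := by
    apply exists_Is
    have : (((v + e ^ 3) ^ 2 + (v + e ^ 3) * e ^ 3 + e ^ 6 : ℤ) : ℚ) = n ^ 3 := by
      exact_mod_cast hs3
    push_cast at this ⊢
    field_simp
    linear_combination this
  have hyu : ((v + e ^ 3 : ℤ) : ℚ) / e ^ 3 + 2 = u / e ^ 3 := by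
    rw [hueq]; push_cast; field_simp; ring
  have hyv : ((v + e ^ 3 : ℤ) : ℚ) / e ^ 3 - 1 = v / e ^ 3 := by
    push_cast; field_simp; ring
  obtain ⟨y3, h3S⟩ := triple hS (by positivity) (by rw [hyu]; positivity) (by rw [hyv]; positivity)
  refine ⟨n, e, v + e ^ 3, he0, hcop, hs3, hnpos, ?_, S, hS, ?_⟩
  · refine le_trans ?_ hKN
    have := ineq6 u v
    rw [← hK2, show u ^ 2 + u * v + v ^ 2 = 3 * n ^ 3 by rw [← hn, hue]; ring] at this
    nlinarith
  · have hxe : x' = ((((v + e ^ 3 : ℤ) : ℚ) / e ^ 3 + 2) ^ 6 - (((v + e ^ 3 : ℤ) : ℚ) / e ^ 3 + 2) ^ 3 *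
        (((v + e ^ 3 : ℤ) : ℚ) / e ^ 3 - 1) ^ 3 + (((v + e ^ 3 : ℤ) : ℚ) / e ^ 3 - 1) ^ 6) /
        (9 * (n / e ^ 2 : ℚ) ^ 2 * ((((v + e ^ 3 : ℤ) : ℚ) / e ^ 3 + 2) *
        (((v + e ^ 3 : ℤ) : ℚ) / e ^ 3 - 1)) ^ 2) := by
      rw [hyu, hyv, hx]
      have : (p ^ 2 - p * q + q ^ 2) * c ^ 2 = (u ^ 6 - u ^ 3 * v ^ 3 + v ^ 6 : ℚ) := by
        rw [hK]; exact_mod_cast hK2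
      have hcc' : (c : ℚ) = -3 * u * v * e * n := by exact_mod_cast hcc
      rw [hcc'] at this
      rw [eq_div_iff (by positivity)]
      field_simp
      linear_combination this
    rw [← hxe] at h3S
    exact hR.eq_or_neg h3S

end P3

namespace P3

lemma d2_le {A d s : ℤ} (hA : 0 < A) (h : s ^ 2 + s * d ^ 3 + d ^ 6 = A ^ 3) : 5 * d ^ 2 ≤ 6 * A := by
  by_contra hh
  push Not at hh
  have h3 : (6 * A) ^ 3 < (5 * d ^ 2) ^ 3 := pow_lt_pow_left₀ hh (by linarith) (by norm_num)
  nlinarith [sq_nonneg (2 * s + d ^ 3), pow_pos hA 3]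

lemma sd_le {A d s : ℤ} (hA : 0 < A) (h : s ^ 2 + s * d ^ 3 + d ^ 6 = A ^ 3) :
    - (s * d) ≤ 13 * A ^ 2 - 11 * A ^ 2 := by
  have h1 := d2_le hA h
  have h2 : 3 * s ^ 2 ≤ 4 * A ^ 3 := by nlinarith [sq_nonneg (2 * d ^ 3 + s)]
  have h3 : 15 * (s * d) ^ 2 ≤ 24 * A ^ 4 := by
    have : (3 * s ^ 2) * (5 * d ^ 2) ≤ (4 * A ^ 3) * (6 * A) :=
      mul_le_mul h2 h1 (by positivity) (by positivity)
    nlinarith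
  have h4 : (-(s * d)) ^ 2 ≤ (2 * A ^ 2) ^ 2 := by nlinarith [pow_pos hA 4]
  have := abs_le_of_sq_le_sq' h4 (by positivity)
  linarith [this.2]

lemma case2 {R : Pt} {A d s g h : ℤ} (hA : 0 < A) (hd : d ≠ 0) (hAd : A ≠ d ^ 2)
    (hR : Is R (A / d ^ 2) (s / d ^ 3)) (heq : s ^ 2 + s * d ^ 3 + d ^ 6 = A ^ 3)
    (hr : g ^ 3 + h ^ 3 - 3 * g * h ^ 2 = d ^ 3) (hs : s = 3 * g * h * (g - h) - d ^ 3) :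
    ∃ (x' y' p q : ℚ) (N D : ℤ), Is (R + PP) x' y' ∧ 3 * p * q * (p - q) = -1 ∧
      x' = p ^ 2 - p * q + q ^ 2 ∧ 0 < N ∧ N ≤ 6 * A ^ 2 ∧ x' * D = N := by
  have hdq : (d : ℚ) ≠ 0 := by exact_mod_cast hd
  have hAq : (A : ℚ) ≠ 0 := by exact_mod_cast hA.ne'
  have hAg : A = g ^ 2 - g * h + h ^ 2 := by
    have : A ^ 3 = (g ^ 2 - g * h + h ^ 2) ^ 3 := by
      rw [← heq, hs]
      linear_combination (-(g ^ 3 + h ^ 3 - 3 * g * h ^ 2) - d ^ 3 + 3 * g * h * (g - h)) * hr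
    exact (Odd.strictMono_pow (by decide : Odd 3)).injective this
  have hRe := hR.eqn
  set x : ℚ := A / d ^ 2 with hxdef
  set y : ℚ := s / d ^ 3 with hydef
  have hx1 : x - 1 ≠ 0 := by
    intro h0
    apply hAd
    have : (A : ℚ) = d ^ 2 := by
      rw [hxdef] at h0; field_simp at h0; linarith
    exact_mod_cast this
  have hx0 : x ≠ 0 := by rw [hxdef]; positivity
  obtain ⟨a, ha⟩ : ∃ a : ℚ, a = g / d := ⟨_, rfl⟩
  obtain ⟨b, hb⟩ : ∃ b : ℚ, b = h / d := ⟨_, rfl⟩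
  have hxab : x = a ^ 2 - a * b + b ^ 2 := by
    rw [hxdef, ha, hb, hAg]; push_cast; field_simp
  have hrab : a ^ 3 + b ^ 3 - 3 * a * b ^ 2 = 1 := by
    have : (g ^ 3 + h ^ 3 - 3 * g * h ^ 2 : ℚ) = d ^ 3 := by exact_mod_cast hr
    rw [ha, hb]; field_simp; linarith
  have htab : y = 3 * a * b * (a - b) - 1 := by
    rw [hydef, ha, hb, hs]; push_cast; field_simp
  obtain ⟨l, hl⟩ : ∃ l : ℚ, l = y / (x - 1) := ⟨_, rfl⟩
  have E1 : l * (x - 1) = y := by rw [hl]; field_simp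
  have E2 : l * (y + 1) = x ^ 2 + x + 1 := by
    apply mul_right_cancel₀ hx1
    linear_combination (y + 1) * E1 + hRe
  have hadd := hR.add PP_is (sub_ne_zero.1 hx1) l (by linarith)
  have hp3 : 3 * ((l * (a - b) + b) / x) * ((a - l * b) / x) *
      ((l * (a - b) + b) / x - (a - l * b) / x) = -1 := by
    have e : 3 * (l * (a - b) + b) * (a - l * b) * (l * a + b - a) = - x ^ 3 := by
      have e1 : 3 * (l * (a - b) + b) * (a - l * b) * (l * a + b - a) =
        -(l ^ 3 + 1 - 3 * l) * (3 * a * b * (a - b)) +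
          3 * l * (l - 1) * (a ^ 3 + b ^ 3 - 3 * a * b ^ 2) := by ring
      have e2 : 3 * a * b * (a - b) = y + 1 := by linarith
      rw [e1, e2, hrab]
      linear_combination -l ^ 2 * E2 - (l * (x + 2) + y) * E1 - hRe
    field_simp
    linear_combination e
  have hxp : l ^ 2 - x - 1 = ((l * (a - b) + b) / x) ^ 2 - ((l * (a - b) + b) / x) * ((a - l * b) / x) +
      ((a - l * b) / x) ^ 2 := by
    have e : x * (l ^ 2 - x - 1) = l ^ 2 - l + 1 := by
      linear_combination l * E1 + E2
    have e2 : (l * (a - b) + b) ^ 2 - (l * (a - b) + b) * (a - l * b) + (a - l * b) ^ 2 =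
        (l ^ 2 - l + 1) * x := by rw [hxab]; ring
    have e3 : ((l * (a - b) + b) / x) ^ 2 - ((l * (a - b) + b) / x) * ((a - l * b) / x) +
      ((a - l * b) / x) ^ 2 = ((l * (a - b) + b) ^ 2 - (l * (a - b) + b) * (a - l * b) + (a - l * b) ^ 2) / x ^ 2 := by
      field_simp
    rw [e3, e2, ← e]; field_simp
  have hND : (l ^ 2 - x - 1) * (((A - d ^ 2) ^ 2 : ℤ) : ℚ) =
      ((A ^ 2 + A * d ^ 2 - 2 * d ^ 4 - s * d : ℤ) : ℚ) := by
    have e : (l ^ 2 - x - 1) * (x - 1) ^ 2 = x ^ 2 + x - 2 - y := by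
      linear_combination (l * (x - 1) + y) * E1 + hRe
    have hxd : x * d ^ 2 = A := by rw [hxdef]; field_simp
    have hyd : y * d ^ 3 = s := by rw [hydef]; field_simp
    push_cast
    rw [← hxd, ← hyd]
    linear_combination (d : ℚ) ^ 4 * e
  refine ⟨_, _, _, _, A ^ 2 + A * d ^ 2 - 2 * d ^ 4 - s * d, (A - d ^ 2) ^ 2, hadd, hp3, hxp, ?_, ?_, hND⟩
  · have h1 : (0 : ℚ) < ((A - d ^ 2) ^ 2 : ℤ) := by
      have : A - d ^ 2 ≠ 0 := sub_ne_zero.2 hAd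
      exact_mod_cast (by positivity : 0 < (A - d ^ 2) ^ 2)
    have h2 : 0 < l ^ 2 - x - 1 := by
      rw [hxp]
      set p := (l * (a - b) + b) / x
      set q := (a - l * b) / x
      have hq0 : q ≠ 0 := by
        intro h0; rw [h0] at hp3; norm_num at hp3
      have : 0 < q ^ 2 := by positivity
      nlinarith [sq_nonneg (2 * p - q)]
    have := mul_pos h2 h1
    rw [hND] at this
    exact_mod_cast this
  · have h1 := d2_le hA heq
    have h2 := sd_le hA heq
    nlinarith [pow_pos hA 2, sq_nonneg (d ^ 2), mul_le_mul_of_nonneg_left h1 hA.le]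

lemma adjust {R : Pt} {A d s : ℤ} (hA : 0 < A) (hd : d ≠ 0) (hAd : A ≠ d ^ 2) (hc : IsCoprime s d)
    (hR : Is R (A / d ^ 2) (s / d ^ 3)) (heq : s ^ 2 + s * d ^ 3 + d ^ 6 = A ^ 3) :
    ∃ (R' : Pt) (x' y' p q : ℚ) (N D : ℤ), (R' = R ∨ R' = R + PP ∨ R' = -R + PP) ∧
      Is R' x' y' ∧ 3 * p * q * (p - q) = -1 ∧
      x' = p ^ 2 - p * q + q ^ 2 ∧ 0 < N ∧ N ≤ 6 * A ^ 2 ∧ x' * D = N := by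
  have hdq : (d : ℚ) ≠ 0 := by exact_mod_cast hd
  have hcube : ∀ g h : ℤ, (⟨g, h⟩ : EI) ^ 3 = ⟨g ^ 3 + h ^ 3 - 3 * g * h ^ 2, 3 * g * h * (g - h)⟩ := by
    intro g h
    ext <;> simp [pow_succ] <;> ring
  obtain ⟨⟨g, h⟩, hα⟩ := eisen_cube s (d ^ 3) A (hc.pow_right) (by rw [← heq]; ring)
  rw [hcube] at hα
  rcases hα with hα | hα | hα
  · have h1 := congrArg QuadraticAlgebra.re hα
    have h2 := congrArg QuadraticAlgebra.im hα
    simp at h1 h2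
    have hAg : A = g ^ 2 - g * h + h ^ 2 := by
      have : A ^ 3 = (g ^ 2 - g * h + h ^ 2) ^ 3 := by
        rw [← heq, show s ^ 2 + s * d ^ 3 + d ^ 6 = s ^ 2 - s * (-d ^ 3) + (-d ^ 3) ^ 2 by ring, h2, h1]
        ring
      exact (Odd.strictMono_pow (by decide : Odd 3)).injective this
    refine ⟨R, _, _, g / d, h / d, A, d ^ 2, Or.inl rfl, hR, ?_, ?_, hA, ?_, ?_⟩
    · have : (-d ^ 3 : ℚ) = 3 * g * h * (g - h) := by exact_mod_cast h2
      field_simp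
      linarith
    · rw [hAg]; push_cast; field_simp
    · nlinarith
    · push_cast; field_simp
  · have h1 := congrArg QuadraticAlgebra.re hα
    have h2 := congrArg QuadraticAlgebra.im hα
    simp at h1 h2
    have hneg : Is (-R) (A / d ^ 2) (((-d ^ 3 - s : ℤ) : ℚ) / d ^ 3) := by
      convert hR.neg using 1
      push_cast; field_simp
    obtain ⟨x', y', p, q, N, D, hh⟩ := case2 (g := h - g) (h := h) hA hd hAd hneg (by rw [← heq]; ring)
      (by linarith) (by linarith)
    exact ⟨_, x', y', p, q, N, D, Or.inr (Or.inr rfl), hh⟩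
  · have h1 := congrArg QuadraticAlgebra.re hα
    have h2 := congrArg QuadraticAlgebra.im hα
    simp at h1 h2
    obtain ⟨x', y', p, q, N, D, hh⟩ := case2 (g := g) (h := h) hA hd hAd hR heq
      (by linarith) (by linarith)
    exact ⟨_, x', y', p, q, N, D, Or.inr (Or.inl rfl), hh⟩

lemma mordell_weil (k : ℕ) : ∀ (A d s : ℤ) (R : Pt), A ≤ k → 0 < A → d ≠ 0 → IsCoprime s d →
    s ^ 2 + s * d ^ 3 + d ^ 6 = A ^ 3 → Is R (A / d ^ 2) (s / d ^ 3) →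
    R ∈ AddSubgroup.zmultiples PP := by
  have hPP : PP ∈ AddSubgroup.zmultiples PP := AddSubgroup.mem_zmultiples PP
  induction k with
  | zero => intro A d s R h1 h2; exfalso; push_cast at h1; lia
  | succ k ih =>
    intro A d s R hAk hA hd hc heq hR
    have hdq : (d : ℚ) ≠ 0 := by exact_mod_cast hd
    by_cases hAd : A = d ^ 2
    · have : (A / d ^ 2 : ℚ) = 1 := by rw [hAd]; push_cast; field_simp
      rw [this] at hR
      rcases hR.eq_or_neg PP_is with rfl | rfl
      · exact hPP
      · exact neg_mem hPP
    have hA2 : 2 ≤ A := by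
      by_contra hh
      have hA1 : A = 1 := by lia
      have := d2_le hA heq
      have : 0 < d ^ 2 := by positivity
      apply hAd; lia
    obtain ⟨R', x', y', p, q, N, D, hR', hI, h3, hx, hN, hNA, hD⟩ := adjust hA hd hAd hc hR heq
    obtain ⟨n, e, t, he, hcop, hn3, hn, hnN, S, hS, hRS⟩ := descent hI h3 hx N D hN hD
    have hlt : n < A := by
      by_contra hh
      have h9 : A ^ 9 ≤ n ^ 9 := pow_le_pow_left₀ hA.le (by lia) 9
      have h7 : (2 : ℤ) ^ 7 ≤ A ^ 7 := pow_le_pow_left₀ (by norm_num) hA2 7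
      nlinarith [pow_pos hA 2]
    have hSm : S ∈ AddSubgroup.zmultiples PP := ih n e t S (by push_cast at hAk; lia) hn he hcop hn3 hS
    have hRm : R' ∈ AddSubgroup.zmultiples PP := by
      rcases hRS with rfl | rfl
      · exact add_mem (add_mem hSm hSm) hSm
      · exact neg_mem (add_mem (add_mem hSm hSm) hSm)
    rcases hR' with rfl | rfl | rfl
    · exact hRm
    · exact (AddSubgroup.add_mem_cancel_right _ hPP).1 hRm
    · exact neg_mem_iff.1 ((AddSubgroup.add_mem_cancel_right _ hPP).1 hRm)

lemma integral_points (x A : ℤ) (h : x ^ 2 + x + 1 = A ^ 3) : A = 1 ∨ A = 7 := by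
  have hA : 0 < A := by
    have : 0 < A ^ 3 := by nlinarith [sq_nonneg (2 * x + 1)]
    exact (Odd.pow_pos_iff (by decide)).1 this
  obtain ⟨R, hR⟩ := exists_Is (x := (A : ℚ)) (y := (x : ℚ)) (by
    have : (x ^ 2 + x + 1 : ℚ) = A ^ 3 := by exact_mod_cast h
    linarith)
  have hm : R ∈ AddSubgroup.zmultiples PP :=
    mordell_weil A.toNat A 1 x R (by lia) hA one_ne_zero isCoprime_one_right (by rw [← h]; ring)
      (by simpa using hR)
  rcases integral_zmultiples R hm _ _ hR A rfl with h | h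
  · left; exact_mod_cast h
  · right; exact_mod_cast h

end P3

namespace P3

lemma luca (X Y : ℤ) (q : ℕ) (hX : 1 ≤ X) (hY : 1 ≤ Y) (hq : 2 ≤ q) (h : X ^ 2 + 3 = 4 * Y ^ q) :
    (X = 1 ∧ Y = 1) ∨ (X = 37 ∧ Y = 7 ∧ q = 3) := by
  have hfin : Y = 1 → (X = 1 ∧ Y = 1) ∨ (X = 37 ∧ Y = 7 ∧ q = 3) := by
    rintro rfl
    left
    rw [one_pow] at h
    exact ⟨by nlinarith, rfl⟩
  obtain ⟨x, hx⟩ : ∃ x, X = 2 * x + 1 := by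
    rcases Int.even_or_odd' X with ⟨c, hc | hc⟩
    · exfalso; rw [hc] at h; ring_nf at h; lia
    · exact ⟨c, hc⟩
  have hxe : x ^ 2 + x + 1 = Y ^ q := by
    rw [hx] at h
    apply mul_left_cancel₀ (by norm_num : (4 : ℤ) ≠ 0)
    linear_combination h
  by_cases h2 : 2 ∣ q
  · obtain ⟨j, rfl⟩ := h2
    have hj : j ≠ 0 := by lia
    have hz : 1 ≤ Y ^ j := one_le_pow₀ hY
    rw [mul_comm 2 j, pow_mul] at h
    have h1 : X < 2 * Y ^ j := by nlinarith
    have hzz : Y ^ j = 1 := by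
      have : (2 * Y ^ j - X) * (2 * Y ^ j + X) = 3 := by linear_combination -h
      nlinarith
    exact hfin ((pow_eq_one_iff_of_nonneg (by lia) hj).1 hzz)
  by_cases h3 : 3 ∣ q
  · obtain ⟨j, rfl⟩ := h3
    have hj : j ≠ 0 := by lia
    rw [mul_comm, pow_mul] at hxe
    rcases integral_points x _ hxe with h7 | h7
    · exact hfin ((pow_eq_one_iff_of_nonneg (by lia) hj).1 h7)
    · right
      have hj1 : j = 1 := by
        by_contra hne
        have hp : (7 : ℕ) = Y.natAbs ^ j := by
          rw [← Int.natAbs_pow, h7]; rfl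
        have := (by norm_num : Nat.Prime 7)
        rw [hp] at this
        exact Nat.Prime.not_prime_pow (by lia) this
      subst hj1
      rw [pow_one] at h7
      subst h7
      refine ⟨?_, rfl, rfl⟩
      norm_num at h
      nlinarith
  · exact hfin (case6 x Y q hY (by lia) (by lia) hxe)

end P3

open Polynomial

/-- Let `k = 3^ℓ` (`ℓ ≥ 1`), `m` an integer with `|m| ≥ 2` and `M = m^{k/3}`.
If `Φ_k(m) = Y^q` with `Y ≥ 1`, `q ≥ 2`, then `X = 2M + 1` satisfies
`X² + 3 = 4Y^q`; by Luca–Tengely–Togbé the only solutions of `X² + 3 = 4Y^q`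
with `X, Y ≥ 1`, `q ≥ 2` are `(1,1)` and `(37,7,3)`; hence `M ∈ {-19,-1,0,18}`. -/
theorem power_of_three_case (k : ℕ) (ℓ : ℕ) (hℓ : 1 ≤ ℓ) (hkl : k = 3 ^ ℓ)
    (m : ℤ) (hm : 2 ≤ |m|) (Y : ℤ) (q : ℕ) (hY : 1 ≤ Y) (hq : 2 ≤ q)
    (h : (cyclotomic k ℤ).eval m = Y ^ q) :
    (2 * m ^ (k / 3) + 1) ^ 2 + 3 = 4 * Y ^ q ∧
      (∀ (X' Y' : ℤ) (q' : ℕ), 1 ≤ X' → 1 ≤ Y' → 2 ≤ q' →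
        X' ^ 2 + 3 = 4 * Y' ^ q' →
          (X' = 1 ∧ Y' = 1) ∨ (X' = 37 ∧ Y' = 7 ∧ q' = 3)) ∧
      m ^ (k / 3) ∈ ({-19, -1, 0, 18} : Set ℤ) := by
  obtain ⟨t, rfl⟩ : ∃ t, ℓ = t + 1 := ⟨ℓ - 1, by lia⟩
  have hk3 : k / 3 = 3 ^ t := by rw [hkl, pow_succ]; simp
  have hcyc : (m ^ (k / 3)) ^ 2 + m ^ (k / 3) + 1 = Y ^ q := by
    have : Fact (Nat.Prime 3) := ⟨by norm_num⟩
    rw [← h, hk3, hkl, cyclotomic_prime_pow_eq_geom_sum (by norm_num : Nat.Prime 3)]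
    simp [Finset.sum_range_succ]
    ring
  have h1 : (2 * m ^ (k / 3) + 1) ^ 2 + 3 = 4 * Y ^ q := by linear_combination 4 * hcyc
  refine ⟨h1, fun X' Y' q' a b c d => P3.luca X' Y' q' a b c d, ?_⟩
  generalize m ^ (k / 3) = M at h1
  have h2 := P3.luca |2 * M + 1| Y q (by
    have : 2 * M + 1 ≠ 0 := by lia
    exact Int.one_le_abs this) hY hq (by rw [sq_abs]; exact h1)
  simp only [Set.mem_insert_iff, Set.mem_singleton_iff]
  rcases h2 with ⟨h2, -⟩ | ⟨h2, -⟩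
  · rcases (abs_eq (by norm_num)).1 h2 with h2 | h2 <;> lia
  · rcases (abs_eq (by norm_num)).1 h2 with h2 | h2 <;> lia
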